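/- arXiv:1409.4350 — 11 statements merged into one kernel-verified Lean document; each statement's English description precedes it below -/
import Mathlib

section
/- For every α, β > 0 and every v ∈ ℝ, the Legendre transform of the function w ↦ (2α/β)·(cosh(βw) − 1) at v equals ψ_{α,β}(v); that is, sup_{w ∈ ℝ} ( v·w − (2α/β)·(cosh(βw) − 1) ) = (v/β)·log((v + √(v² + 4α²))/(2α)) − (1/β)·√(v² + 4α²) + 2α/β. -/
open Real Filter Topology Set

/-- `ψ_{α,β}(v)`, the dissipation potential from Kramers' rates. -/
noncomputable def psi (a b v : ℝ) : ℝ :=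
  v / b * Real.log ((v + Real.sqrt (v ^ 2 + 4 * a ^ 2)) / (2 * a))
    - 1 / b * Real.sqrt (v ^ 2 + 4 * a ^ 2) + 2 * a / b

/-- `ψ*_{α,β}(w)`, the dual dissipation potential. -/
noncomputable def psiStar (a b w : ℝ) : ℝ :=
  2 * a / b * (Real.cosh (b * w) - 1)

/-- The graph of `cosh` lies above its tangent lines. -/
theorem cosh_add_sinh_mul_sub_le_cosh (s t : ℝ) :
    Real.cosh s + Real.sinh s * (t - s) ≤ Real.cosh t := by
  have h₁ : Real.exp s * (t - s + 1) ≤ Real.exp t := by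
    calc Real.exp s * (t - s + 1) ≤ Real.exp s * Real.exp (t - s) := by
          gcongr; exact Real.add_one_le_exp _
      _ = Real.exp t := by rw [← Real.exp_add]; congr 1; ring
  have h₂ : Real.exp (-s) * (s - t + 1) ≤ Real.exp (-t) := by
    calc Real.exp (-s) * (s - t + 1) ≤ Real.exp (-s) * Real.exp (s - t) := by
          gcongr; exact Real.add_one_le_exp _
      _ = Real.exp (-t) := by rw [← Real.exp_add]; congr 1; ring
  rw [Real.cosh_eq, Real.cosh_eq, Real.sinh_eq]
  linarith

/-- `ψ_{α,β}` in the coordinate `v = 2α sinh s`. -/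
theorem psi_two_mul_sinh {a : ℝ} (ha : 0 < a) (b s : ℝ) :
    psi a b (2 * a * Real.sinh s) =
      2 * a / b * (s * Real.sinh s - Real.cosh s + 1) := by
  have hsqrt : Real.sqrt ((2 * a * Real.sinh s) ^ 2 + 4 * a ^ 2) = 2 * a * Real.cosh s := by
    rw [← Real.sqrt_sq (by positivity : 0 ≤ 2 * a * Real.cosh s)]
    congr 1
    rw [mul_pow _ (Real.cosh s), Real.cosh_sq]
    ring
  have hexp : (2 * a * Real.sinh s + 2 * a * Real.cosh s) / (2 * a) = Real.exp s := by
    rw [← mul_add, Real.sinh_add_cosh, mul_div_cancel_left₀ _ (by positivity)]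
  rw [psi, hsqrt, hexp, Real.log_exp]
  ring

/-- for every `α, β > 0` and `v ∈ ℝ`, the Legendre transform of
`w ↦ (2α/β)(cosh(βw) − 1)` at `v` equals `ψ_{α,β}(v)`; i.e. `ψ_{α,β}(v)` is the least
upper bound of `{ v·w − ψ*_{α,β}(w) : w ∈ ℝ }`. -/
theorem legendre_of_psiStar_eq_psi (a b v : ℝ) (ha : 0 < a) (hb : 0 < b) :
    IsLUB (Set.range fun w : ℝ => v * w - psiStar a b w) (psi a b v) := by
  obtain ⟨s, hs⟩ := Real.sinh_surjective (v / (2 * a))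
  obtain rfl : v = 2 * a * Real.sinh s := by rw [hs]; field_simp
  rw [psi_two_mul_sinh ha]
  refine IsGreatest.isLUB ⟨⟨s / b, ?_⟩, ?_⟩
  · simp only [psiStar, mul_div_cancel₀ s hb.ne']
    ring
  · rintro _ ⟨w, rfl⟩
    have hw : 2 * a * Real.sinh s * w = 2 * a / b * (Real.sinh s * (b * w)) := by
      field_simp
    simp only [psiStar]
    rw [hw, ← mul_sub]
    gcongr
    linarith [cosh_add_sinh_mul_sub_le_cosh s (b * w)]
end

section
/- For every r⁺, r⁻ > 0 and every v ∈ ℝ, the Legendre transform of the Hamiltonian H(p) := r⁺·(e^p − 1) + r⁻·(e^{−p} − 1) is given explicitly by sup_{p ∈ ℝ} ( v·p − H(p) ) = v·log( (v + √(v² + 4·r⁺·r⁻)) / (2·r⁺) ) − √(v² + 4·r⁺·r⁻) + r⁺ + r⁻. -/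
open Real Filter Topology Set

/-- the Legendre transform of the Hamiltonian
`H(p) = r⁺(e^p − 1) + r⁻(e^{−p} − 1)` of a birth-death process with constant rates
`r⁺, r⁻ > 0` is given explicitly by
`sup_p (v·p − H(p)) = v·log((v + √(v² + 4r⁺r⁻))/(2r⁺)) − √(v² + 4r⁺r⁻) + r⁺ + r⁻`. -/
theorem legendre_of_hamiltonian (rp rm v : ℝ) (hrp : 0 < rp) (hrm : 0 < rm) :
    IsLUB
      (Set.range fun p : ℝ =>
        v * p - (rp * (Real.exp p - 1) + rm * (Real.exp (-p) - 1)))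
      (v * Real.log ((v + Real.sqrt (v ^ 2 + 4 * rp * rm)) / (2 * rp))
        - Real.sqrt (v ^ 2 + 4 * rp * rm) + rp + rm) := by
  set s := Real.sqrt (v ^ 2 + 4 * rp * rm) with hs
  have hprod : 0 < rp * rm := mul_pos hrp hrm
  have hsq : s ^ 2 = v ^ 2 + 4 * rp * rm := Real.sq_sqrt (by nlinarith [sq_nonneg v])
  have habs : |v| < s := by
    rw [hs, ← Real.sqrt_sq_eq_abs]
    exact Real.sqrt_lt_sqrt (sq_nonneg v) (by nlinarith)
  have hpos : 0 < v + s := by linarith [neg_abs_le v]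
  have hneg : 0 < s - v := by linarith [le_abs_self v]
  set q := Real.log ((v + s) / (2 * rp)) with hq
  have hexp : Real.exp q = (v + s) / (2 * rp) := Real.exp_log (by positivity)
  have hright : rp * Real.exp q = (v + s) / 2 := by
    rw [hexp]
    field_simp
  have hleft : rm * Real.exp (-q) = (s - v) / 2 := by
    rw [Real.exp_neg, hexp]
    field_simp
    linarith
  refine IsGreatest.isLUB ⟨⟨q, by dsimp only; linarith⟩, ?_⟩
  rintro _ ⟨p, rfl⟩
  have hp : rp * Real.exp p = (v + s) / 2 * Real.exp (p - q) := by
    rw [← hright, mul_assoc, ← Real.exp_add, add_sub_cancel]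
  have hm : rm * Real.exp (-p) = (s - v) / 2 * Real.exp (-(p - q)) := by
    rw [← hleft, mul_assoc, ← Real.exp_add]
    ring_nf
  have hp' := mul_le_mul_of_nonneg_left (Real.add_one_le_exp (p - q)) (half_pos hpos).le
  have hm' := mul_le_mul_of_nonneg_left (Real.add_one_le_exp (-(p - q))) (half_pos hneg).le
  dsimp only
  linarith
end

section
/- Let ω > 0 and let α_n, β_n > 0 satisfy β_n → 0, α_n → ∞ and α_n·β_n → ω. Then ψ*_{α_n,β_n}(w) → ω·w² and ψ_{α_n,β_n}(v) → v²/(4ω) as n → ∞, uniformly on every compact subset of ℝ. -/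
open Real Filter Topology Set

/-- A second order expansion at `0`: if `φ 0 = 0` and `φ` has derivative `f`, where `f 0 = 0` and
`f` has derivative `1` at `0`, then `φ x = x ^ 2 / 2 + o(x ^ 2)`. -/
theorem isLittleO_sub_half_sq {φ f : ℝ → ℝ} (hφ0 : φ 0 = 0) (hφ : ∀ x, HasDerivAt φ (f x) x)
    (hf0 : f 0 = 0) (hf : HasDerivAt f 1 0) :
    (fun x => φ x - x ^ 2 / 2) =o[𝓝 0] fun x => x ^ 2 := by
  have hquot : Tendsto (fun x => (φ x - x ^ 2 / 2) / x ^ 2) (𝓝[≠] 0) (𝓝 0) := by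
    refine HasDerivAt.lhopital_zero_nhdsNE (f' := fun x => f x - x) (g' := fun x => 2 * x)
      ?_ ?_ ?_ ?_ ?_ ?_
    · filter_upwards with x
      refine ((hφ x).sub ((hasDerivAt_pow 2 x).div_const 2)).congr_deriv ?_
      norm_num
    · filter_upwards with x
      refine (hasDerivAt_pow 2 x).congr_deriv ?_
      norm_num
    · filter_upwards [self_mem_nhdsWithin] with x hx
      exact mul_ne_zero two_ne_zero hx
    · have hcont : ContinuousAt (fun x => φ x - x ^ 2 / 2) 0 :=
        (hφ 0).continuousAt.sub (by fun_prop)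
      simpa [ContinuousAt, hφ0] using hcont.tendsto.mono_left nhdsWithin_le_nhds
    · have hcont : ContinuousAt (fun x : ℝ => x ^ 2) 0 := by fun_prop
      simpa [ContinuousAt] using hcont.tendsto.mono_left nhdsWithin_le_nhds
    · have hslope := ((hasDerivAt_iff_tendsto_slope.1 hf).sub_const 1).div_const 2
      rw [sub_self, zero_div] at hslope
      refine hslope.congr' ?_
      filter_upwards [self_mem_nhdsWithin] with x hx
      have hx' : x ≠ 0 := hx
      rw [slope_def_field, hf0]
      field_simp
      simp
  have hpunct : (fun x => φ x - x ^ 2 / 2) =o[𝓝[≠] 0] fun x => x ^ 2 := by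
    refine (Asymptotics.isLittleO_iff_tendsto' ?_).2 hquot
    filter_upwards [self_mem_nhdsWithin] with x hx h
    exact absurd (pow_eq_zero_iff two_ne_zero |>.1 h) hx
  rw [← nhdsNE_sup_pure]
  exact hpunct.sup (Asymptotics.isLittleO_pure.2 (by simp [hφ0]))

/-- Rescaling a function with quadratic expansion `x ^ 2 / 2` at `0` by `s n * φ (t n * w)`, where
`t n → 0` and `s n * t n ^ 2 → c`, gives `c / 2 * w ^ 2` in the limit, uniformly on bounded sets. -/
theorem tendstoUniformlyOn_rescale {ι : Type*} {l : Filter ι} {φ : ℝ → ℝ}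
    (hφ : (fun x => φ x - x ^ 2 / 2) =o[𝓝 0] fun x => x ^ 2) {s t : ι → ℝ} {c : ℝ}
    (ht : Tendsto t l (𝓝 0)) (hst : Tendsto (fun n => s n * t n ^ 2) l (𝓝 c))
    {K : Set ℝ} (hK : Bornology.IsBounded K) :
    TendstoUniformlyOn (fun n w => s n * φ (t n * w)) (fun w => c / 2 * w ^ 2) l K := by
  obtain ⟨R, hR, hKR⟩ := hK.exists_pos_norm_le
  rw [Metric.tendstoUniformlyOn_iff]
  intro ε hε
  set η : ℝ := ε / (2 * R ^ 2 * (|c| + 1)) with hη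
  have hηpos : 0 < η := by positivity
  obtain ⟨δ, hδ, hball⟩ := Metric.eventually_nhds_iff.1 (hφ.def hηpos)
  have hε' : 0 < ε / (2 * R ^ 2) := by positivity
  filter_upwards [Metric.tendsto_nhds.1 ht (δ / R) (by positivity),
    Metric.tendsto_nhds.1 hst _ hε', hst.abs.eventually_lt_const (lt_add_one |c|)]
    with n hn hcn hbd w hw
  have hwR : |w| ≤ R := hKR w hw
  have hw2 : w ^ 2 ≤ R ^ 2 := sq_le_sq' (abs_le.1 hwR).1 (abs_le.1 hwR).2
  rw [Real.dist_eq, sub_zero, lt_div_iff₀ hR] at hn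
  rw [Real.dist_eq] at hcn
  have hsmall : |φ (t n * w) - (t n * w) ^ 2 / 2| ≤ η * (t n * w) ^ 2 := by
    have hlt : dist (t n * w) 0 < δ := by
      rw [Real.dist_eq, sub_zero, abs_mul]
      exact (mul_le_mul_of_nonneg_left hwR (abs_nonneg _)).trans_lt hn
    simpa only [Real.norm_eq_abs, abs_of_nonneg (sq_nonneg (t n * w))] using hball hlt
  have hrem : |s n * (φ (t n * w) - (t n * w) ^ 2 / 2)| ≤ ε / 2 := by
    calc |s n * (φ (t n * w) - (t n * w) ^ 2 / 2)|
        ≤ |s n| * (η * (t n * w) ^ 2) := by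
          rw [abs_mul]
          exact mul_le_mul_of_nonneg_left hsmall (abs_nonneg _)
      _ = η * |s n * t n ^ 2| * w ^ 2 := by
          rw [abs_mul, abs_of_nonneg (sq_nonneg (t n))]
          ring
      _ ≤ η * (|c| + 1) * R ^ 2 := by gcongr
      _ = ε / 2 := by
          rw [hη]
          field_simp
  have hmain : |(s n * t n ^ 2 - c) / 2 * w ^ 2| ≤ ε / 4 := by
    calc |(s n * t n ^ 2 - c) / 2 * w ^ 2| = |s n * t n ^ 2 - c| / 2 * w ^ 2 := by
          rw [abs_mul, abs_div, abs_of_nonneg (sq_nonneg w), abs_two]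
      _ ≤ ε / (2 * R ^ 2) / 2 * R ^ 2 := by gcongr
      _ = ε / 4 := by
          field_simp
          norm_num
  rw [dist_comm, Real.dist_eq]
  calc |s n * φ (t n * w) - c / 2 * w ^ 2|
      = |s n * (φ (t n * w) - (t n * w) ^ 2 / 2) + (s n * t n ^ 2 - c) / 2 * w ^ 2| := by
        congr 1
        ring
    _ ≤ ε / 2 + ε / 4 := (abs_add_le _ _).trans (add_le_add hrem hmain)
    _ < ε := by linarith

theorem hasDerivAt_mul_arsinh_sub_sqrt (x : ℝ) :
    HasDerivAt (fun x => x * arsinh x - √(1 + x ^ 2) + 1) (arsinh x) x := by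
  have hpos : 0 < 1 + x ^ 2 := by positivity
  have hsqrt := ((hasDerivAt_pow 2 x).const_add 1).sqrt hpos.ne'
  refine ((((hasDerivAt_id x).mul (hasDerivAt_arsinh x)).sub hsqrt).add_const 1).congr_deriv ?_
  have : √(1 + x ^ 2) ≠ 0 := (Real.sqrt_pos.2 hpos).ne'
  simp only [id]
  field_simp
  norm_num
  ring

theorem psi_eq_arsinh {a : ℝ} (ha : 0 < a) (b v : ℝ) :
    psi a b v = 2 * a / b * ((2 * a)⁻¹ * v * arsinh ((2 * a)⁻¹ * v)
      - √(1 + ((2 * a)⁻¹ * v) ^ 2) + 1) := by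
  have hsqrt : √(v ^ 2 + 4 * a ^ 2) = 2 * a * √(1 + ((2 * a)⁻¹ * v) ^ 2) := by
    rw [← Real.sqrt_sq (by positivity : 0 ≤ 2 * a), ← Real.sqrt_mul (by positivity),
      Real.sqrt_sq (by positivity)]
    congr 1
    field_simp
    ring
  have harg : (v + 2 * a * √(1 + ((2 * a)⁻¹ * v) ^ 2)) / (2 * a)
      = (2 * a)⁻¹ * v + √(1 + ((2 * a)⁻¹ * v) ^ 2) := by
    field_simp
  rw [psi, hsqrt, harg, arsinh]
  generalize Real.log _ = L
  generalize √_ = S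
  field_simp

/-- if `β_n → 0`, `α_n → ∞` and `α_n β_n → ω > 0`, then
`ψ*_{α_n,β_n}(w) → ω w²` and `ψ_{α_n,β_n}(v) → v²/(4ω)` uniformly on every
compact subset of `ℝ`. -/
theorem quadratic_limit_locally_uniform
    (ω : ℝ) (hω : 0 < ω) (a b : ℕ → ℝ)
    (ha : ∀ n, 0 < a n) (hb : ∀ n, 0 < b n)
    (hb0 : Tendsto b atTop (𝓝 0)) (hainf : Tendsto a atTop atTop)
    (hab : Tendsto (fun n => a n * b n) atTop (𝓝 ω))
    (K : Set ℝ) (hK : IsCompact K) :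
    TendstoUniformlyOn (fun n w => psiStar (a n) (b n) w) (fun w => ω * w ^ 2) atTop K ∧
    TendstoUniformlyOn (fun n v => psi (a n) (b n) v) (fun v => v ^ 2 / (4 * ω)) atTop K := by
  constructor
  · have hcosh : (fun x => (cosh x - 1) - x ^ 2 / 2) =o[𝓝 0] fun x => x ^ 2 :=
      isLittleO_sub_half_sq (f := sinh) (by simp) (fun x => (hasDerivAt_cosh x).sub_const 1)
        sinh_zero (by simpa using hasDerivAt_sinh 0)
    have hst : Tendsto (fun n => 2 * a n / b n * b n ^ 2) atTop (𝓝 (2 * ω)) := by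
      refine (hab.const_mul 2).congr fun n => ?_
      have := (hb n).ne'
      field_simp
    refine (tendstoUniformlyOn_rescale hcosh hb0 hst hK.isBounded).congr_right fun w _ => ?_
    ring
  · have harsinh : (fun x => (x * arsinh x - √(1 + x ^ 2) + 1) - x ^ 2 / 2)
        =o[𝓝 0] fun x => x ^ 2 :=
      isLittleO_sub_half_sq (by simp) hasDerivAt_mul_arsinh_sub_sqrt arsinh_zero
        (by simpa using hasDerivAt_arsinh 0)
    have ht : Tendsto (fun n => (2 * a n)⁻¹) atTop (𝓝 0) :=
      (hainf.const_mul_atTop two_pos).inv_tendsto_atTop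
    have hst : Tendsto (fun n => 2 * a n / b n * (2 * a n)⁻¹ ^ 2) atTop (𝓝 (2 * ω)⁻¹) := by
      refine ((hab.const_mul 2).inv₀ (by positivity)).congr fun n => ?_
      have := (hb n).ne'
      have := (ha n).ne'
      field_simp
    refine ((tendstoUniformlyOn_rescale harsinh ht hst hK.isBounded).congr
      (.of_forall fun n v _ => (psi_eq_arsinh (ha n) (b n) v).symm)).congr_right fun v _ => ?_
    field_simp
    ring
end

section
/- (Liminf inequality for the quadratic limit.) Let ω > 0 and let α_n, β_n > 0 satisfy β_n → 0, α_n → ∞, α_n·β_n → ω. Let x_n, x ∈ W^{1,1}(0,T) be such that x_n → x strongly in L¹(0,T) and ẋ_n → ẋ weakly in L¹(0,T) (i.e. ∫₀ᵀ ẋ_n·g → ∫₀ᵀ ẋ·g for every g ∈ L^∞(0,T)). Then liminf_{n→∞} J_{α_n,β_n}(x_n) ≥ J_Q(x). -/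
open MeasureTheory Real Filter Topology Set

/-- The tangent line inequality for the convex function `cosh`. -/
lemma cosh_add_sinh_mul_le_cosh (s u : ℝ) :
    Real.cosh s + Real.sinh s * (u - s) ≤ Real.cosh u := by
  have hpos : Real.exp s * (u - s + 1) ≤ Real.exp u := by
    calc Real.exp s * (u - s + 1) ≤ Real.exp s * Real.exp (u - s) := by
          gcongr; exact Real.add_one_le_exp _
      _ = Real.exp u := by rw [← Real.exp_add]; congr 1; ring
  have hneg : Real.exp (-s) * (-(u - s) + 1) ≤ Real.exp (-u) := by
    calc Real.exp (-s) * (-(u - s) + 1) ≤ Real.exp (-s) * Real.exp (-(u - s)) := by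
          gcongr; exact Real.add_one_le_exp _
      _ = Real.exp (-u) := by rw [← Real.exp_add]; congr 1; ring
  rw [Real.cosh_eq, Real.sinh_eq, Real.cosh_eq]
  linarith

/-- The Fenchel–Young inequality for the pair `psi`, `psiStar`. -/
lemma mul_le_psi_add_psiStar {a b : ℝ} (ha : 0 < a) (hb : 0 < b) (v w : ℝ) :
    v * w ≤ psi a b v + psiStar a b w := by
  set s := Real.arsinh (v / (2 * a)) with hs
  have hv : v = 2 * a * Real.sinh s := by rw [hs, Real.sinh_arsinh]; field_simp
  have hsqrt : Real.sqrt (v ^ 2 + 4 * a ^ 2) = 2 * a * Real.cosh s := by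
    rw [Real.sqrt_eq_iff_mul_self_eq (by positivity) (by positivity), hv]
    linear_combination -4 * a ^ 2 * Real.cosh_sq s
  have hlog : Real.log ((v + Real.sqrt (v ^ 2 + 4 * a ^ 2)) / (2 * a)) = s := by
    rw [hsqrt, hv, ← mul_add, mul_div_cancel_left₀ _ (by positivity), Real.sinh_add_cosh,
      Real.log_exp]
  have htangent := cosh_add_sinh_mul_le_cosh s (b * w)
  rw [psi, psiStar, hlog, hsqrt, hv]
  have hgap : 2 * a * Real.sinh s / b * s - 1 / b * (2 * a * Real.cosh s) + 2 * a / b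
      + 2 * a / b * (Real.cosh (b * w) - 1) - 2 * a * Real.sinh s * w
      = 2 * a / b * (Real.cosh (b * w) - (Real.cosh s + Real.sinh s * (b * w - s))) := by
    field_simp; ring
  have hnonneg : 0 ≤ 2 * a / b *
      (Real.cosh (b * w) - (Real.cosh s + Real.sinh s * (b * w - s))) :=
    mul_nonneg (by positivity) (by linarith)
  linarith

lemma psiStar_neg (a b w : ℝ) : psiStar a b (-w) = psiStar a b w := by
  simp [psiStar]

lemma continuous_psiStar (a b : ℝ) : Continuous (psiStar a b) := by
  unfold psiStar; fun_prop

lemma one_add_sq_div_two_le_cosh (y : ℝ) : 1 + y ^ 2 / 2 ≤ Real.cosh y := by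
  have hsinh : (y / 2) ^ 2 ≤ Real.sinh (y / 2) ^ 2 := by
    rw [sq_le_sq]
    rcases le_total 0 (y / 2) with h | h
    · rw [abs_of_nonneg h]
      exact (Real.self_le_sinh_iff.2 h).trans (le_abs_self _)
    · rw [abs_of_nonpos h]
      exact (neg_le_neg (Real.sinh_le_self_iff.2 h)).trans (neg_le_abs _)
  have hdouble : Real.cosh y = Real.cosh (y / 2) ^ 2 + Real.sinh (y / 2) ^ 2 := by
    rw [← Real.cosh_two_mul]; congr 1; ring
  rw [hdouble, Real.cosh_sq]
  linarith

lemma cosh_sub_one_le (y : ℝ) : Real.cosh y - 1 ≤ y ^ 2 / 2 * Real.exp (y ^ 2 / 2) := by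
  have hcosh := Real.cosh_le_exp_half_sq y
  have hexp := mul_le_mul_of_nonneg_right (Real.add_one_le_exp (-(y ^ 2 / 2)))
    (Real.exp_pos (y ^ 2 / 2)).le
  rw [← Real.exp_add, neg_add_cancel, Real.exp_zero] at hexp
  linarith

lemma le_psiStar {a b : ℝ} (ha : 0 < a) (hb : 0 < b) (w : ℝ) :
    a * b * w ^ 2 ≤ psiStar a b w := by
  calc a * b * w ^ 2 = 2 * a / b * ((b * w) ^ 2 / 2) := by field_simp
    _ ≤ psiStar a b w := by
      unfold psiStar
      gcongr
      linarith [one_add_sq_div_two_le_cosh (b * w)]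

lemma psiStar_le {a b : ℝ} (ha : 0 < a) (hb : 0 < b) (w : ℝ) :
    psiStar a b w ≤ a * b * w ^ 2 * Real.exp ((b * w) ^ 2 / 2) := by
  calc psiStar a b w ≤ 2 * a / b * ((b * w) ^ 2 / 2 * Real.exp ((b * w) ^ 2 / 2)) := by
        unfold psiStar
        gcongr
        exact cosh_sub_one_le _
    _ = a * b * w ^ 2 * Real.exp ((b * w) ^ 2 / 2) := by field_simp

/-- In the regime `b → 0`, `a * b → ω`, the potentials `psiStar` converge continuously to
`ω * w ^ 2`. -/
lemma tendsto_psiStar {ω : ℝ} {a b w : ℕ → ℝ} {w₀ : ℝ}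
    (ha : ∀ n, 0 < a n) (hb : ∀ n, 0 < b n) (hb0 : Tendsto b atTop (𝓝 0))
    (hab : Tendsto (fun n => a n * b n) atTop (𝓝 ω)) (hw : Tendsto w atTop (𝓝 w₀)) :
    Tendsto (fun n => psiStar (a n) (b n) (w n)) atTop (𝓝 (ω * w₀ ^ 2)) := by
  have hlower : Tendsto (fun n => a n * b n * w n ^ 2) atTop (𝓝 (ω * w₀ ^ 2)) :=
    hab.mul (hw.pow 2)
  have hexp : Tendsto (fun n => Real.exp ((b n * w n) ^ 2 / 2)) atTop (𝓝 1) := by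
    simpa using (((hb0.mul hw).pow 2).div_const 2).rexp
  refine tendsto_of_tendsto_of_tendsto_of_le_of_le hlower
    (by simpa using hlower.mul hexp) (fun n => le_psiStar (ha n) (hb n) _)
    (fun n => psiStar_le (ha n) (hb n) _)

/-- Convergence of the integrated dual potentials along uniformly bounded sequences converging
in measure. -/
lemma tendsto_integral_psiStar {Ω : Type*} [MeasurableSpace Ω] {μ : Measure Ω}
    [IsFiniteMeasure μ] {ω : ℝ} {a b : ℕ → ℝ}
    (ha : ∀ n, 0 < a n) (hb : ∀ n, 0 < b n) (hb0 : Tendsto b atTop (𝓝 0))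
    (hab : Tendsto (fun n => a n * b n) atTop (𝓝 ω))
    {w : ℕ → Ω → ℝ} {w₀ : Ω → ℝ} {M : ℝ} (hM : ∀ n t, |w n t| ≤ M)
    (hmeas : ∀ n, AEStronglyMeasurable (w n) μ) (hw : TendstoInMeasure μ w atTop w₀) :
    Tendsto (fun n => ∫ t, psiStar (a n) (b n) (w n t) ∂μ) atTop
      (𝓝 (∫ t, ω * w₀ t ^ 2 ∂μ)) := by
  obtain ⟨A, hA⟩ := hab.bddAbove_range
  obtain ⟨B, hB⟩ := hb0.bddAbove_range
  have hA' (n) : a n * b n ≤ A := hA ⟨n, rfl⟩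
  have hB' (n) : b n ≤ B := hB ⟨n, rfl⟩
  have hApos : 0 ≤ A := (mul_pos (ha 0) (hb 0)).le.trans (hA' 0)
  refine tendsto_of_subseq_tendsto fun ns hns => ?_
  obtain ⟨ms, hms, hae⟩ := (hw.comp hns).exists_seq_tendsto_ae'
  have hnsms := hns.comp hms
  refine ⟨ms, tendsto_integral_of_dominated_convergence
    (fun _ => A * M ^ 2 * Real.exp ((B * M) ^ 2 / 2)) (fun k => ?_) (integrable_const _)
    (fun k => Eventually.of_forall fun t => ?_) ?_⟩
  · exact (continuous_psiStar _ _).comp_aestronglyMeasurable (hmeas _)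
  · have hn := hB' (ns (ms k))
    have hbpos := hb (ns (ms k))
    have hMt := hM (ns (ms k)) t
    have hsq : w (ns (ms k)) t ^ 2 ≤ M ^ 2 := sq_le_sq' (abs_le.1 hMt).1 (abs_le.1 hMt).2
    have hlow := le_psiStar (ha (ns (ms k))) hbpos (w (ns (ms k)) t)
    have hprod := mul_pos (ha (ns (ms k))) hbpos
    rw [Real.norm_of_nonneg (le_trans (by positivity) hlow)]
    refine (psiStar_le (ha _) hbpos _).trans ?_
    rw [mul_pow, mul_pow]
    gcongr
    exact hA' _
  · filter_upwards [hae] with t ht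
    exact tendsto_psiStar (fun _ => ha _) (fun _ => hb _) (hb0.comp hnsms) (hab.comp hnsms) ht

lemma ofReal_integral_le_lintegral_ofReal {Ω : Type*} [MeasurableSpace Ω] {μ : Measure Ω}
    {f : Ω → ℝ} (hf : Integrable f μ) :
    ENNReal.ofReal (∫ t, f t ∂μ) ≤ ∫⁻ t, ENNReal.ofReal (f t) ∂μ := by
  rw [integral_eq_lintegral_pos_part_sub_lintegral_neg_part hf]
  exact (ENNReal.ofReal_le_ofReal (sub_le_self _ ENNReal.toReal_nonneg)).trans
    ENNReal.ofReal_toReal_le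

lemma integral_sub_add {Ω : Type*} [MeasurableSpace Ω] {μ : Measure Ω} {f g h : Ω → ℝ}
    (hf : Integrable f μ) (hg : Integrable g μ) (hh : Integrable h μ) :
    ∫ t, (f t - g t + h t) ∂μ = ∫ t, f t ∂μ - ∫ t, g t ∂μ + ∫ t, h t ∂μ := by
  rw [← integral_sub hf hg]
  exact integral_add (hf.sub hg) hh

/-- A primitive of an integrable function is continuous. -/
lemma continuousOn_of_eq_primitive {T : ℝ} (hT : 0 < T) {y y' : ℝ → ℝ}
    (hy' : IntegrableOn y' (Set.Ioo 0 T))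
    (hy : ∀ t ∈ Set.Icc 0 T, y t = y 0 + ∫ s in (0:ℝ)..t, y' s) :
    ContinuousOn y (Set.Icc 0 T) := by
  have hprim := intervalIntegral.continuousOn_primitive_interval (a := 0) (b := T) (f := y')
    (μ := volume) (by rwa [uIcc_of_le hT.le, integrableOn_Icc_iff_integrableOn_Ioo])
  rw [uIcc_of_le hT.le] at hprim
  exact (continuousOn_const.add hprim).congr hy

/-- Convergence in measure is preserved by composition with a function that is continuous in its
first variable. -/
lemma tendstoInMeasure_comp_continuous {Ω : Type*} [MeasurableSpace Ω] {μ : Measure Ω}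
    [IsFiniteMeasure μ] {u : ℕ → Ω → ℝ} {u₀ : Ω → ℝ} {F : ℝ → Ω → ℝ}
    (hF : ∀ t, Continuous fun y => F y t)
    (hmeas : ∀ n, AEStronglyMeasurable (fun t => F (u n t) t) μ)
    (hu : TendstoInMeasure μ u atTop u₀) :
    TendstoInMeasure μ (fun n t => F (u n t) t) atTop (fun t => F (u₀ t) t) := by
  rw [exists_seq_tendstoInMeasure_atTop_iff hmeas]
  intro ns hns
  obtain ⟨ms, hms, hae⟩ := TendstoInMeasure.exists_seq_tendsto_ae (hu.comp hns.tendsto_atTop)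
  refine ⟨ms, hms, ?_⟩
  filter_upwards [hae] with t ht
  exact ((hF t).tendsto _).comp ht

/-- A continuous function of a bounded measurable function is integrable on a finite measure
space. -/
lemma integrable_comp_of_abs_le {Ω : Type*} [MeasurableSpace Ω] {μ : Measure Ω}
    [IsFiniteMeasure μ] {φ : ℝ → ℝ} (hφ : Continuous φ) {u : Ω → ℝ}
    (hu : AEStronglyMeasurable u μ) {M : ℝ} (hM : ∀ t, |u t| ≤ M) :
    Integrable (fun t => φ (u t)) μ := by
  obtain ⟨C, hC⟩ := (isCompact_Icc (a := -M) (b := M)).exists_bound_of_continuousOn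
    hφ.continuousOn
  exact Integrable.of_bound (hφ.comp_aestronglyMeasurable hu) C
    (Eventually.of_forall fun t => hC _ (abs_le.1 (hM t)))

/-- liminf inequality for the quadratic limit: let `β_n → 0`, `α_n → ∞`,
`α_n β_n → ω > 0`; let `x_n, x ∈ W^{1,1}(0,T)` (represented by their absolutely continuous
representatives together with their a.e. derivatives) with `x_n → x` strongly in `L¹(0,T)`
and `ẋ_n ⇀ ẋ` weakly in `L¹(0,T)`.  Then
`liminf_n J_{α_n,β_n}(x_n) ≥ J_Q(x)`, where the functionals (with values in `[0,∞]`) are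
`J_{α,β}(y) = ∫₀ᵀ [ψ_{α,β}(ẏ) + ψ*_{α,β}(∇E(y,t)) + ẏ·∇E(y,t)] dt` and
`J_Q(y) = ∫₀ᵀ [ẏ²/(4ω) + ω·∇E(y,t)² + ẏ·∇E(y,t)] dt`. -/
theorem quadratic_liminf
    (T : ℝ) (hT : 0 < T)
    -- the energy `E` with spatial derivative `∇E = DE`, satisfying condition (2.8)
    (E DE : ℝ → ℝ → ℝ) (R L : ℝ)
    (hEcont : Continuous fun p : ℝ × ℝ => E p.1 p.2)
    (hDEcont : Continuous fun p : ℝ × ℝ => DE p.1 p.2)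
    (hDE : ∀ y t, HasDerivAt (fun z => E z t) (DE y t) y)
    (hEnonneg : ∀ y t, 0 ≤ E y t)
    (hDEbound : ∀ y t, |DE y t| ≤ R)
    (hDELip : ∀ y s t, |DE y t - DE y s| ≤ L * |t - s|)
    -- the scaling regime
    (ω : ℝ) (hω : 0 < ω)
    (a b : ℕ → ℝ) (ha : ∀ n, 0 < a n) (hb : ∀ n, 0 < b n)
    (hb0 : Tendsto b atTop (𝓝 0)) (hainf : Tendsto a atTop atTop)
    (hab : Tendsto (fun n => a n * b n) atTop (𝓝 ω))
    -- the curves `x_n` and `x` in `W^{1,1}(0,T)`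
    (xn xn' : ℕ → ℝ → ℝ) (x x' : ℝ → ℝ)
    (hxn'int : ∀ n, IntegrableOn (xn' n) (Set.Ioo 0 T))
    (hxnac : ∀ n, ∀ t ∈ Set.Icc 0 T, xn n t = xn n 0 + ∫ s in (0:ℝ)..t, xn' n s)
    (hx'int : IntegrableOn x' (Set.Ioo 0 T))
    (hxac : ∀ t ∈ Set.Icc 0 T, x t = x 0 + ∫ s in (0:ℝ)..t, x' s)
    -- strong L¹ convergence of `x_n` to `x`
    (hL1 : Tendsto (fun n => ∫ t in Set.Ioo 0 T, |xn n t - x t|) atTop (𝓝 0))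
    -- weak L¹ convergence of the derivatives
    (hweak : ∀ g : ℝ → ℝ, Measurable g → (∃ M, ∀ t, |g t| ≤ M) →
      Tendsto (fun n => ∫ t in Set.Ioo 0 T, xn' n t * g t) atTop
        (𝓝 (∫ t in Set.Ioo 0 T, x' t * g t))) :
    (∫⁻ t in Set.Ioo 0 T, ENNReal.ofReal
        (x' t ^ 2 / (4 * ω) + ω * DE (x t) t ^ 2 + x' t * DE (x t) t)) ≤
      Filter.liminf
        (fun n => ∫⁻ t in Set.Ioo 0 T, ENNReal.ofReal
          (psi (a n) (b n) (xn' n t) + psiStar (a n) (b n) (DE (xn n t) t)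
            + xn' n t * DE (xn n t) t))
        Filter.atTop := by
  set μ : Measure ℝ := volume.restrict (Set.Ioo 0 T)
  have hxn_meas (n) : AEStronglyMeasurable (xn n) μ :=
    ((continuousOn_of_eq_primitive hT (hxn'int n) (hxnac n)).mono
      Ioo_subset_Icc_self).aestronglyMeasurable measurableSet_Ioo
  have hx_meas : AEStronglyMeasurable x μ :=
    ((continuousOn_of_eq_primitive hT hx'int hxac).mono
      Ioo_subset_Icc_self).aestronglyMeasurable measurableSet_Ioo
  have hDxn_meas (n) : AEStronglyMeasurable (fun t => DE (xn n t) t) μ :=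
    hDEcont.comp_aestronglyMeasurable ((hxn_meas n).prodMk aestronglyMeasurable_id)
  have hDx_meas : AEStronglyMeasurable (fun t => DE (x t) t) μ :=
    hDEcont.comp_aestronglyMeasurable (hx_meas.prodMk aestronglyMeasurable_id)
  have hdiff_int (n) : Integrable (xn n - x) μ := by
    have hcont := (continuousOn_of_eq_primitive hT (hxn'int n) (hxnac n)).sub
      (continuousOn_of_eq_primitive hT hx'int hxac)
    exact (hcont.integrableOn_Icc (μ := volume)).mono_set Ioo_subset_Icc_self
  have hx_inMeasure : TendstoInMeasure μ xn atTop x := by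
    refine tendstoInMeasure_of_tendsto_eLpNorm one_ne_zero hxn_meas hx_meas ?_
    have hnorm (n) : eLpNorm (xn n - x) 1 μ = ENNReal.ofReal (∫ t, |xn n t - x t| ∂μ) := by
      rw [eLpNorm_one_eq_lintegral_enorm,
        ← ofReal_integral_norm_eq_lintegral_enorm (hdiff_int n)]
      rfl
    simp_rw [hnorm]
    simpa using ENNReal.tendsto_ofReal hL1
  have hR : 0 ≤ R := (abs_nonneg _).trans (hDEbound 0 0)
  have hdual (g : ℝ → ℝ) (hg : Measurable g) (M : ℝ) (hM : ∀ t, |g t| ≤ M) :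
      Tendsto (fun n => ∫ t, psiStar (a n) (b n) (g t - DE (xn n t) t) ∂μ) atTop
        (𝓝 (∫ t, ω * (g t - DE (x t) t) ^ 2 ∂μ)) :=
    tendsto_integral_psiStar ha hb hb0 hab (M := M + R)
      (fun n t => (abs_sub _ _).trans (add_le_add (hM t) (hDEbound _ _)))
      (fun n => hg.aestronglyMeasurable.sub (hDxn_meas n))
      (tendstoInMeasure_comp_continuous (F := fun y t => g t - DE y t)
        (fun t => continuous_const.sub (hDEcont.comp (by fun_prop : Continuous fun y => (y, t))))
        (fun n => hg.aestronglyMeasurable.sub (hDxn_meas n)) hx_inMeasure)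
  have hpsi_int (n) (g : ℝ → ℝ) (hg : Measurable g) (M : ℝ) (hM : ∀ t, |g t| ≤ M) :
      Integrable (fun t => psiStar (a n) (b n) (g t - DE (xn n t) t)) μ := by
    refine integrable_comp_of_abs_le (continuous_psiStar _ _)
      (hg.aestronglyMeasurable.sub (hDxn_meas n)) (M := M + R) fun t => ?_
    exact (abs_sub _ _).trans (add_le_add (hM t) (hDEbound _ _))
  have hsq_int (g : ℝ → ℝ) (hg : Measurable g) (M : ℝ) (hM : ∀ t, |g t| ≤ M) :
      Integrable (fun t => ω * (g t - DE (x t) t) ^ 2) μ := by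
    refine integrable_comp_of_abs_le (φ := fun y => ω * y ^ 2) (by fun_prop)
      (hg.aestronglyMeasurable.sub hDx_meas) (M := M + R) fun t => ?_
    exact (abs_sub _ _).trans (add_le_add (hM t) (hDEbound _ _))
  have hmul_int {y' : ℝ → ℝ} (hy' : Integrable y' μ) (g : ℝ → ℝ)
      (hg : Measurable g) (M : ℝ) (hM : ∀ t, |g t| ≤ M) :
      Integrable (fun t => y' t * g t) μ :=
    Integrable.mul_bdd hy' hg.aestronglyMeasurable (Eventually.of_forall hM : ∀ᵐ t ∂μ, ‖g t‖ ≤ M)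
  have hzero : Measurable (fun _ : ℝ => (0 : ℝ)) := measurable_const
  have hzero_le : ∀ t : ℝ, |(fun _ : ℝ => (0 : ℝ)) t| ≤ 0 := by simp
  have hlower (g : ℝ → ℝ) (hg : Measurable g) (M : ℝ) (hM : ∀ t, |g t| ≤ M) :
      ENNReal.ofReal (∫ t, (x' t * g t - ω * (g t - DE (x t) t) ^ 2
          + ω * (0 - DE (x t) t) ^ 2) ∂μ) ≤
        liminf (fun n => ∫⁻ t, ENNReal.ofReal (psi (a n) (b n) (xn' n t)
          + psiStar (a n) (b n) (DE (xn n t) t) + xn' n t * DE (xn n t) t) ∂μ) atTop := by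
    have hlim : Tendsto (fun n => ENNReal.ofReal (∫ t, (xn' n t * g t
        - psiStar (a n) (b n) (g t - DE (xn n t) t)
        + psiStar (a n) (b n) (0 - DE (xn n t) t)) ∂μ)) atTop
        (𝓝 (ENNReal.ofReal (∫ t, (x' t * g t - ω * (g t - DE (x t) t) ^ 2
          + ω * (0 - DE (x t) t) ^ 2) ∂μ))) := by
      refine ENNReal.tendsto_ofReal ?_
      rw [integral_sub_add (hmul_int hx'int g hg M hM) (hsq_int g hg M hM)
        (hsq_int _ hzero 0 hzero_le)]
      refine Tendsto.congr (fun n => ?_) (((hweak g hg ⟨M, hM⟩).sub (hdual g hg M hM)).add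
        (hdual _ hzero 0 hzero_le))
      rw [integral_sub_add (hmul_int (hxn'int n) g hg M hM) (hpsi_int n g hg M hM)
        (hpsi_int n _ hzero 0 hzero_le)]
    rw [← hlim.liminf_eq]
    refine liminf_le_liminf (Eventually.of_forall fun n => ?_)
    refine (ofReal_integral_le_lintegral_ofReal (((hmul_int (hxn'int n) g hg M hM).sub
      (hpsi_int n g hg M hM)).add (hpsi_int n _ hzero 0 hzero_le))).trans
      (lintegral_mono fun t => ENNReal.ofReal_le_ofReal ?_)
    have hFY := mul_le_psi_add_psiStar (ha n) (hb n) (xn' n t) (g t - DE (xn n t) t)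
    simp only [Pi.add_apply, Pi.sub_apply, zero_sub, psiStar_neg]
    linarith
  -- Truncations of the optimal test function `DE (x t) t + x' t / (2 * ω)`.
  have hx'_meas : AEStronglyMeasurable x' μ := hx'int.aestronglyMeasurable
  set y := hx_meas.mk x
  set y' := hx'_meas.mk x'
  have hy : Measurable y := hx_meas.stronglyMeasurable_mk.measurable
  have hy' : Measurable y' := hx'_meas.stronglyMeasurable_mk.measurable
  let g (k : ℕ) (t : ℝ) : ℝ := if |y' t| ≤ k then DE (y t) t + y' t / (2 * ω) else 0
  have hg (k) : Measurable (g k) := by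
    refine Measurable.ite (measurableSet_le (by fun_prop) measurable_const) ?_ measurable_const
    exact (hDEcont.measurable.comp (hy.prodMk measurable_id)).add (hy'.div_const _)
  have hgM (k : ℕ) (t) : |g k t| ≤ R + k / (2 * ω) := by
    by_cases h : |y' t| ≤ k
    · simp only [g, if_pos h]
      refine (abs_add_le _ _).trans (add_le_add (hDEbound _ _) ?_)
      rw [abs_div, abs_of_pos (by positivity : 0 < 2 * ω)]
      gcongr
    · simp only [g, if_neg h, abs_zero]
      positivity
  let G (k : ℕ) (t : ℝ) : ℝ :=
    x' t * g k t - ω * (g k t - DE (x t) t) ^ 2 + ω * (0 - DE (x t) t) ^ 2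
  have hG_int (k) : Integrable (G k) μ :=
    ((hmul_int hx'int _ (hg k) _ (hgM k)).sub (hsq_int _ (hg k) _ (hgM k))).add
      (hsq_int _ hzero 0 hzero_le)
  let F (t : ℝ) : ℝ := x' t ^ 2 / (4 * ω) + ω * DE (x t) t ^ 2 + x' t * DE (x t) t
  have hF (t) : 0 ≤ F t := by
    have hsquare : F t = (x' t + 2 * ω * DE (x t) t) ^ 2 / (4 * ω) := by
      simp only [F]; field_simp; ring
    rw [hsquare]; positivity
  have hGF : ∀ᵐ t ∂μ, ∀ k : ℕ, G k t = if |x' t| ≤ k then F t else 0 := by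
    filter_upwards [hx_meas.ae_eq_mk, hx'_meas.ae_eq_mk] with t ht ht' k
    simp only [G, g, F, y, y', ← ht, ← ht']
    split_ifs
    · field_simp; ring
    · ring
  calc ∫⁻ t, ENNReal.ofReal (F t) ∂μ
      ≤ ∫⁻ t, liminf (fun k => ENNReal.ofReal (G k t)) atTop ∂μ := by
        refine lintegral_mono_ae ?_
        filter_upwards [hGF] with t ht
        refine le_of_eq (Tendsto.liminf_eq (tendsto_const_nhds.congr' ?_)).symm
        filter_upwards [eventually_ge_atTop ⌈|x' t|⌉₊] with k hk
        rw [ht k, if_pos (Nat.ceil_le.1 hk)]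
    _ ≤ liminf (fun k => ∫⁻ t, ENNReal.ofReal (G k t) ∂μ) atTop :=
        lintegral_liminf_le' fun k => (hG_int k).aemeasurable.ennreal_ofReal
    _ ≤ _ := by
        refine liminf_le_of_le (by isBoundedDefault) fun c hc => ?_
        obtain ⟨k, hk⟩ := hc.exists
        refine hk.trans ?_
        rw [← ofReal_integral_eq_lintegral_ofReal (hG_int k)]
        · exact hlower _ (hg k) _ (hgM k)
        · filter_upwards [hGF] with t ht
          rw [ht k]
          split_ifs
          exacts [hF t, le_rfl]
end

section
/- (Recovery sequence for the quadratic limit.) Let ω > 0 and let α_n, β_n > 0 satisfy β_n → 0, α_n → ∞, α_n·β_n → ω. Then for every x ∈ W^{1,1}(0,T), limsup_{n→∞} J_{α_n,β_n}(x) ≤ J_Q(x); in particular the constant (trivial) sequence x_n = x is a recovery sequence for the Mosco convergence of J_{α_n,β_n} to J_Q. -/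
open MeasureTheory Real Filter Topology Set

/-- The dissipation potential is dominated by its quadratic approximation. -/
theorem psi_le_sq_div {a b : ℝ} (ha : 0 < a) (hb : 0 < b) (v : ℝ) :
    psi a b v ≤ v ^ 2 / (4 * (a * b)) := by
  obtain ⟨s, rfl⟩ : ∃ s, v = 2 * a * sinh s :=
    ⟨arsinh (v / (2 * a)), by rw [sinh_arsinh]; field_simp⟩
  have hsqrt : √((2 * a * sinh s) ^ 2 + 4 * a ^ 2) = 2 * a * cosh s := by
    rw [show (2 * a * sinh s) ^ 2 + 4 * a ^ 2 = (2 * a * cosh s) ^ 2 by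
      rw [mul_pow _ (cosh s), cosh_sq]; ring]
    exact sqrt_sq (by positivity)
  have hlog : log ((2 * a * sinh s + 2 * a * cosh s) / (2 * a)) = s := by
    rw [← mul_add, mul_div_cancel_left₀ _ (by positivity), sinh_add_cosh, log_exp]
  have hcosh : 1 + s ^ 2 / 2 ≤ cosh s := by
    rw [← cosh_abs, ← sq_abs]
    have h := self_le_sinh_iff.2 (show 0 ≤ |s| / 2 by positivity)
    have h2 : cosh |s| = 1 + 2 * sinh (|s| / 2) ^ 2 := by
      rw [show cosh |s| = cosh (2 * (|s| / 2)) by ring_nf, cosh_two_mul, cosh_sq]; ring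
    have h3 : (|s| / 2) ^ 2 ≤ sinh (|s| / 2) ^ 2 := by gcongr
    linarith
  have hkey : s * sinh s - cosh s + 1 ≤ sinh s ^ 2 / 2 := by
    linarith [sq_nonneg (sinh s - s)]
  calc psi a b (2 * a * sinh s) = 2 * a / b * (s * sinh s - cosh s + 1) := by
        rw [psi, hsqrt, hlog]; ring
    _ ≤ 2 * a / b * (sinh s ^ 2 / 2) := by gcongr
    _ = (2 * a * sinh s) ^ 2 / (4 * (a * b)) := by field_simp; ring

theorem psiStar_le_mul_exp {a b : ℝ} (ha : 0 < a) (hb : 0 < b) (w : ℝ) :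
    psiStar a b w ≤ a * b * exp ((b * w) ^ 2 / 2) * w ^ 2 := by
  have h : cosh (b * w) - 1 ≤ (b * w) ^ 2 / 2 * exp ((b * w) ^ 2 / 2) := by
    have h1 := cosh_le_exp_half_sq (b * w)
    have h2 := mul_le_mul_of_nonneg_left (add_one_le_exp (-((b * w) ^ 2 / 2)))
      (exp_pos ((b * w) ^ 2 / 2)).le
    rw [← exp_add, add_neg_cancel, exp_zero] at h2
    linarith
  calc psiStar a b w ≤ 2 * a / b * ((b * w) ^ 2 / 2 * exp ((b * w) ^ 2 / 2)) := by
        rw [psiStar]; gcongr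
    _ = a * b * exp ((b * w) ^ 2 / 2) * w ^ 2 := by field_simp

/-- Comparison of the integrand of `J_{α,β}` with that of `J_Q`, with errors that vanish as
`β → 0` and `αβ → ω`. -/
theorem kramers_integrand_le {a b ω R : ℝ} (ha : 0 < a) (hb : 0 < b) (hω : 0 < ω)
    (v : ℝ) {w : ℝ} (hw : |w| ≤ R) :
    psi a b v + psiStar a b w + v * w ≤
      (1 + 2 * |ω / (a * b) - 1|) * (v ^ 2 / (4 * ω) + ω * w ^ 2 + v * w)
        + (2 * ω * |ω / (a * b) - 1|
          + |a * b * exp ((b * R) ^ 2 / 2) - ω|) * R ^ 2 := by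
  have hwR : w ^ 2 ≤ R ^ 2 := sq_le_sq.2 (hw.trans (le_abs_self R))
  have hstar : psiStar a b w ≤ ω * w ^ 2 + |a * b * exp ((b * R) ^ 2 / 2) - ω| * R ^ 2 :=
    calc psiStar a b w ≤ a * b * exp ((b * w) ^ 2 / 2) * w ^ 2 := psiStar_le_mul_exp ha hb w
      _ ≤ a * b * exp ((b * R) ^ 2 / 2) * w ^ 2 := by
        rw [mul_pow, mul_pow]; gcongr
      _ = ω * w ^ 2 + (a * b * exp ((b * R) ^ 2 / 2) - ω) * w ^ 2 := by ring
      _ ≤ ω * w ^ 2 + |a * b * exp ((b * R) ^ 2 / 2) - ω| * w ^ 2 := by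
        gcongr; exact le_abs_self _
      _ ≤ _ := by gcongr
  have hquad : v ^ 2 / (4 * ω) ≤
      2 * (v ^ 2 / (4 * ω) + ω * w ^ 2 + v * w) + 2 * ω * R ^ 2 := by
    have h1 : 0 ≤ (v + 4 * ω * w) ^ 2 / (4 * ω) := by positivity
    have h2 : (v + 4 * ω * w) ^ 2 / (4 * ω) = v ^ 2 / (4 * ω) + 2 * (v * w) + 4 * ω * w ^ 2 := by
      field_simp; ring
    have h3 : ω * w ^ 2 ≤ ω * R ^ 2 := by gcongr
    linarith
  have hpsi : psi a b v ≤ v ^ 2 / (4 * ω) + |ω / (a * b) - 1| *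
      (2 * (v ^ 2 / (4 * ω) + ω * w ^ 2 + v * w) + 2 * ω * R ^ 2) :=
    calc psi a b v ≤ v ^ 2 / (4 * (a * b)) := psi_le_sq_div ha hb v
      _ = v ^ 2 / (4 * ω) + (ω / (a * b) - 1) * (v ^ 2 / (4 * ω)) := by field_simp; ring
      _ ≤ v ^ 2 / (4 * ω) + |ω / (a * b) - 1| * (v ^ 2 / (4 * ω)) := by
        gcongr; exact le_abs_self _
      _ ≤ _ := by gcongr
  linarith

/-- recovery sequence for the quadratic limit: let `β_n → 0`, `α_n → ∞`,
`α_n β_n → ω > 0`.  Then for every `x ∈ W^{1,1}(0,T)` (represented by its absolutely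
continuous representative and its a.e. derivative `x'`),
`limsup_n J_{α_n,β_n}(x) ≤ J_Q(x)`: the constant sequence `x_n = x` is a recovery
sequence for the Mosco convergence of `J_{α_n,β_n}` to `J_Q`.  Both functionals take
values in `[0,∞]`. -/
theorem quadratic_limsup_trivial_recovery
    (T : ℝ) (hT : 0 < T)
    -- the energy `E` with spatial derivative `∇E = DE`, satisfying condition (2.8)
    (E DE : ℝ → ℝ → ℝ) (R L : ℝ)
    (hEcont : Continuous fun p : ℝ × ℝ => E p.1 p.2)
    (hDEcont : Continuous fun p : ℝ × ℝ => DE p.1 p.2)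
    (hDE : ∀ y t, HasDerivAt (fun z => E z t) (DE y t) y)
    (hEnonneg : ∀ y t, 0 ≤ E y t)
    (hDEbound : ∀ y t, |DE y t| ≤ R)
    (hDELip : ∀ y s t, |DE y t - DE y s| ≤ L * |t - s|)
    -- the scaling regime
    (ω : ℝ) (hω : 0 < ω)
    (a b : ℕ → ℝ) (ha : ∀ n, 0 < a n) (hb : ∀ n, 0 < b n)
    (hb0 : Tendsto b atTop (𝓝 0)) (hainf : Tendsto a atTop atTop)
    (hab : Tendsto (fun n => a n * b n) atTop (𝓝 ω))
    -- the curve `x` in `W^{1,1}(0,T)`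
    (x x' : ℝ → ℝ)
    (hx'int : IntegrableOn x' (Set.Ioo 0 T))
    (hxac : ∀ t ∈ Set.Icc 0 T, x t = x 0 + ∫ s in (0:ℝ)..t, x' s) :
    Filter.limsup
        (fun n => ∫⁻ t in Set.Ioo 0 T, ENNReal.ofReal
          (psi (a n) (b n) (x' t) + psiStar (a n) (b n) (DE (x t) t)
            + x' t * DE (x t) t))
        Filter.atTop ≤
      ∫⁻ t in Set.Ioo 0 T, ENNReal.ofReal
        (x' t ^ 2 / (4 * ω) + ω * DE (x t) t ^ 2 + x' t * DE (x t) t) := by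
  set μ := volume.restrict (Ioo (0 : ℝ) T)
  set q : ℝ → ℝ := fun t => x' t ^ 2 / (4 * ω) + ω * DE (x t) t ^ 2 + x' t * DE (x t) t
  rcases eq_or_ne (∫⁻ t, ENNReal.ofReal (q t) ∂μ) ⊤ with htop | htop
  · exact htop ▸ le_top
  set δ : ℕ → ℝ := fun n => 2 * |ω / (a n * b n) - 1|
  set κ : ℕ → ℝ := fun n => (2 * ω * |ω / (a n * b n) - 1|
    + |a n * b n * exp ((b n * R) ^ 2 / 2) - ω|) * R ^ 2
  have hratio : Tendsto (fun n => |ω / (a n * b n) - 1|) atTop (𝓝 0) := by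
    simpa [hω.ne'] using ((tendsto_const_nhds (x := ω)).div hab hω.ne' |>.sub_const 1).abs
  have hδ : Tendsto δ atTop (𝓝 0) := by simpa using hratio.const_mul 2
  have hexp : Tendsto (fun n => |a n * b n * exp ((b n * R) ^ 2 / 2) - ω|) atTop (𝓝 0) := by
    have h := (((hb0.mul_const R).pow 2).div_const 2).rexp
    simpa using ((hab.mul h).sub_const ω).abs
  have hκ : Tendsto κ atTop (𝓝 0) := by
    simpa using ((hratio.const_mul (2 * ω)).add hexp).mul_const (R ^ 2)
  have hbound : ∀ n, ∫⁻ t, ENNReal.ofReal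
      (psi (a n) (b n) (x' t) + psiStar (a n) (b n) (DE (x t) t) + x' t * DE (x t) t) ∂μ ≤
      ENNReal.ofReal (1 + δ n) * ∫⁻ t, ENNReal.ofReal (q t) ∂μ
        + ENNReal.ofReal (κ n) * μ univ := fun n => by
    have hδ0 : 0 ≤ 1 + δ n := by positivity
    rw [← lintegral_const_mul' _ _ ENNReal.ofReal_ne_top, ← lintegral_const,
      ← lintegral_add_right _ measurable_const]
    refine lintegral_mono fun t => ?_
    rw [← ENNReal.ofReal_mul hδ0]
    exact (ENNReal.ofReal_le_ofReal
      (kramers_integrand_le (ha n) (hb n) hω (x' t) (hDEbound (x t) t))).trans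
      ENNReal.ofReal_add_le
  have hlim : Tendsto (fun n => ENNReal.ofReal (1 + δ n) * ∫⁻ t, ENNReal.ofReal (q t) ∂μ
      + ENNReal.ofReal (κ n) * μ univ) atTop (𝓝 (∫⁻ t, ENNReal.ofReal (q t) ∂μ)) := by
    have h1 := ENNReal.Tendsto.mul_const (b := ∫⁻ t, ENNReal.ofReal (q t) ∂μ)
      (ENNReal.tendsto_ofReal (hδ.const_add 1)) (Or.inr htop)
    have h2 := ENNReal.Tendsto.mul_const (b := μ univ)
      (ENNReal.tendsto_ofReal hκ) (Or.inr (by simp [μ]))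
    simpa using h1.add h2
  exact (limsup_le_limsup (Eventually.of_forall hbound)).trans hlim.limsup_eq.le
end

section
/- (Generator convergence.) Let E : ℝ → ℝ be C¹ with ∇E := E′ bounded and uniformly continuous, and let ω, h > 0. Let α_n, β_n > 0 satisfy α_n·β_n → ω and n·β_n → 1/h. For f : ℝ → ℝ of class C², bounded with bounded and uniformly continuous f′ and f″, define Ω_n f(x) := n·α_n·e^{−β_n·∇E(x)}·( f(x + 1/n) − f(x) ) + n·α_n·e^{β_n·∇E(x)}·( f(x − 1/n) − f(x) ). Then sup_{x ∈ ℝ} | Ω_n f(x) − ( −2ω·∇E(x)·f′(x) + ω·h·f″(x) ) | → 0 as n → ∞. -/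
open Real Filter Topology Set

/-- Second-order Taylor estimate: the remainder is at most `η t²` when `f''` oscillates by at most
`η` on the ball of radius `|t|` around `y`. -/
lemma abs_taylor_two_remainder_le {f f' f'' : ℝ → ℝ}
    (hf1 : ∀ y, HasDerivAt f (f' y) y) (hf2 : ∀ y, HasDerivAt f' (f'' y) y)
    {y t η : ℝ} (hη : ∀ z, |z - y| ≤ |t| → |f'' z - f'' y| ≤ η) :
    |f (y + t) - f y - t * f' y - t ^ 2 / 2 * f'' y| ≤ η * t ^ 2 := by
  have hη0 : 0 ≤ η := (abs_nonneg _).trans (hη y (by simp))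
  have hconv : Convex ℝ (Metric.closedBall y |t|) := convex_closedBall y |t|
  have hy : y ∈ Metric.closedBall y |t| := Metric.mem_closedBall_self (abs_nonneg t)
  have hball : ∀ z ∈ Metric.closedBall y |t|, |z - y| ≤ |t| := fun z hz => by
    simpa [Real.dist_eq] using hz
  have hlin : ∀ c x : ℝ, HasDerivAt (fun x : ℝ => x * c) c x := fun c x => by
    simpa using (hasDerivAt_id x).mul_const c
  have hfirst : ∀ z ∈ Metric.closedBall y |t|,
      ‖f' z - f' y - (z - y) * f'' y‖ ≤ η * |t| := by
    intro z hz
    have hderiv : ∀ x ∈ Metric.closedBall y |t|,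
        HasDerivWithinAt (fun x => f' x - x * f'' y) (f'' x - f'' y)
          (Metric.closedBall y |t|) x := fun x _ =>
      ((hf2 x).sub (hlin (f'' y) x)).hasDerivWithinAt
    have hle := hconv.norm_image_sub_le_of_norm_hasDerivWithin_le hderiv
      (fun x hx => hη x (hball x hx)) hy hz
    calc ‖f' z - f' y - (z - y) * f'' y‖
        = ‖(f' z - z * f'' y) - (f' y - y * f'' y)‖ := by congr 1; ring
      _ ≤ η * ‖z - y‖ := hle
      _ ≤ η * |t| := mul_le_mul_of_nonneg_left (hball z hz) hη0
  have hderiv : ∀ x ∈ Metric.closedBall y |t|,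
      HasDerivWithinAt (fun x => f x - x * f' y - (x - y) ^ 2 / 2 * f'' y)
        (f' x - f' y - (x - y) * f'' y) (Metric.closedBall y |t|) x := fun x _ => by
    have hsq : HasDerivAt (fun x : ℝ => (x - y) ^ 2 / 2 * f'' y) ((x - y) * f'' y) x :=
      (((((hasDerivAt_id x).sub_const y).pow 2).div_const 2).mul_const (f'' y)).congr_deriv
        (by simp)
    exact (((hf1 x).sub (hlin (f' y) x)).sub hsq).hasDerivWithinAt
  have hyt : y + t ∈ Metric.closedBall y |t| := by simp
  have hle := hconv.norm_image_sub_le_of_norm_hasDerivWithin_le hderiv hfirst hy hyt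
  calc |f (y + t) - f y - t * f' y - t ^ 2 / 2 * f'' y|
      = ‖(f (y + t) - (y + t) * f' y - (y + t - y) ^ 2 / 2 * f'' y)
          - (f y - y * f' y - (y - y) ^ 2 / 2 * f'' y)‖ := by
        rw [Real.norm_eq_abs]; congr 1; ring
    _ ≤ η * |t| * ‖y + t - y‖ := hle
    _ = η * t ^ 2 := by
        rw [add_sub_cancel_left, Real.norm_eq_abs, mul_assoc, abs_mul_abs_self, sq]

/-- Pointwise error of the jump generator against the diffusion generator, with
`p` and `q` the Taylor remainders of the two increments, and `d`, `u`, `v` the values of the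
drift and of the first two derivatives. -/
lemma abs_jump_generator_sub_le {N A B R M ω k d u v p q η : ℝ}
    (hN : 0 < N) (hA : 0 < A) (hB : 0 < B) (hd : |d| ≤ R) (hBR : B * R ≤ 1)
    (hu : |u| ≤ M) (hv : |v| ≤ M)
    (hp : |p| ≤ η * (1 / N) ^ 2) (hq : |q| ≤ η * (1 / N) ^ 2) :
    |N * A * Real.exp (-B * d) * ((1 / N) * u + (1 / N) ^ 2 / 2 * v + p)
        + N * A * Real.exp (B * d) * (-(1 / N) * u + (1 / N) ^ 2 / 2 * v + q)
        - (-2 * ω * d * u + k * v)|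
      ≤ 2 * M * (A * B * B * R ^ 2 + |A * B - ω| * R)
        + M * (A / N * (B * R) ^ 2 + |A / N - k|) + 6 * (A / N) * η := by
  have hM : 0 ≤ M := (abs_nonneg u).trans hu
  have hBd : |B * d| ≤ B * R := by
    rw [abs_mul, abs_of_pos hB]; exact mul_le_mul_of_nonneg_left hd hB.le
  have hBd1 : |B * d| ≤ 1 := hBd.trans hBR
  have hsq : (B * d) ^ 2 ≤ (B * R) ^ 2 := sq_le_sq' (by linarith [(abs_le.mp hBd).1])
    (abs_le.mp hBd).2
  have hplus := (Real.abs_exp_sub_one_sub_id_le hBd1).trans hsq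
  have hminus := Real.abs_exp_sub_one_sub_id_le (x := -B * d) (by simpa [abs_mul] using hBd1)
  have hminus : |Real.exp (-B * d) - 1 - -B * d| ≤ (B * R) ^ 2 := by
    refine hminus.trans (le_of_eq_of_le ?_ hsq); ring
  have hexp : ∀ x : ℝ, x ≤ 1 → Real.exp x ≤ 3 := fun x hx =>
    (Real.exp_le_exp.mpr hx).trans (by linarith [Real.exp_one_lt_d9])
  have hep3 := hexp (B * d) (abs_le.mp hBd1).2
  have hem3 := hexp (-B * d) (by linarith [(abs_le.mp hBd1).1])
  have hep0 := Real.exp_pos (B * d)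
  have hem0 := Real.exp_pos (-B * d)
  generalize Real.exp (B * d) = ep at *
  generalize Real.exp (-B * d) = em at *
  have hc : 0 < A / N := div_pos hA hN
  have hsinh : |(ep - em) / 2 - B * d| ≤ (B * R) ^ 2 := by
    rw [abs_le] at hplus hminus ⊢; constructor <;> linarith [hplus.1, hplus.2, hminus.1, hminus.2]
  have hcosh : |(ep + em) / 2 - 1| ≤ (B * R) ^ 2 := by
    rw [abs_le] at hplus hminus ⊢; constructor <;> linarith [hplus.1, hplus.2, hminus.1, hminus.2]
  have hdrift : |2 * u * (A * ((ep - em) / 2 - B * d) + (A * B - ω) * d)|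
      ≤ 2 * M * (A * B * B * R ^ 2 + |A * B - ω| * R) := by
    rw [abs_mul, abs_mul, abs_two]
    refine mul_le_mul (by linarith) ?_ (abs_nonneg _) (by linarith)
    refine (abs_add_le _ _).trans (add_le_add ?_ ?_)
    · rw [abs_mul, abs_of_pos hA]
      exact (mul_le_mul_of_nonneg_left hsinh hA.le).trans_eq (by ring)
    · rw [abs_mul]; exact mul_le_mul_of_nonneg_left hd (abs_nonneg _)
  have hdiff : |v * (A / N * ((ep + em) / 2 - 1) + (A / N - k))|
      ≤ M * (A / N * (B * R) ^ 2 + |A / N - k|) := by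
    rw [abs_mul]
    refine mul_le_mul hv ?_ (abs_nonneg _) hM
    refine (abs_add_le _ _).trans (add_le_add ?_ le_rfl)
    rw [abs_mul, abs_of_pos hc]; exact mul_le_mul_of_nonneg_left hcosh hc.le
  have hrem : |N * A * (em * p + ep * q)| ≤ 6 * (A / N) * η := by
    have hsum : |em * p + ep * q| ≤ 6 * (η * (1 / N) ^ 2) := by
      refine (abs_add_le _ _).trans ?_
      rw [abs_mul, abs_mul, abs_of_pos hem0, abs_of_pos hep0]
      have h1 := mul_le_mul hem3 hp (abs_nonneg _) (by norm_num)
      have h2 := mul_le_mul hep3 hq (abs_nonneg _) (by norm_num)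
      linarith
    rw [abs_mul, abs_of_pos (mul_pos hN hA)]
    refine (mul_le_mul_of_nonneg_left hsum (mul_pos hN hA).le).trans_eq ?_
    field_simp
  calc _ = |-(2 * u * (A * ((ep - em) / 2 - B * d) + (A * B - ω) * d))
          + v * (A / N * ((ep + em) / 2 - 1) + (A / N - k))
          + N * A * (em * p + ep * q)| := by congr 1; field_simp; ring
    _ ≤ _ := by
      refine (abs_add_le _ _).trans (add_le_add ((abs_add_le _ _).trans ?_) hrem)
      rw [abs_neg]; exact add_le_add hdrift hdiff

/-- generator convergence: let `E : ℝ → ℝ` be `C¹` with `∇E = E′` bounded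
and uniformly continuous, `ω, h > 0`, `α_n β_n → ω` and `n β_n → 1/h`.  Then for every
`f` of class `C²`, bounded with bounded and uniformly continuous `f′, f″`, the generators
`Ω_n f(x) = n α_n e^{−β_n ∇E(x)}(f(x+1/n) − f(x)) + n α_n e^{β_n ∇E(x)}(f(x−1/n) − f(x))`
converge uniformly on `ℝ` to `Ω f(x) = −2ω ∇E(x) f′(x) + ω h f″(x)`. -/
theorem generator_convergence_to_diffusion
    (E DE : ℝ → ℝ) (hE : ∀ y, HasDerivAt E (DE y) y)
    (R : ℝ) (hDEb : ∀ y, |DE y| ≤ R) (hDEuc : UniformContinuous DE)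
    (ω h : ℝ) (hω : 0 < ω) (hh : 0 < h)
    (a b : ℕ → ℝ) (ha : ∀ n, 0 < a n) (hb : ∀ n, 0 < b n)
    (hab : Tendsto (fun n => a n * b n) atTop (𝓝 ω))
    (hnb : Tendsto (fun n : ℕ => (n : ℝ) * b n) atTop (𝓝 (1 / h)))
    (f f' f'' : ℝ → ℝ)
    (hf1 : ∀ y, HasDerivAt f (f' y) y) (hf2 : ∀ y, HasDerivAt f' (f'' y) y)
    (Mf : ℝ) (hfb : ∀ y, |f y| ≤ Mf) (hf'b : ∀ y, |f' y| ≤ Mf) (hf''b : ∀ y, |f'' y| ≤ Mf)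
    (hf'uc : UniformContinuous f') (hf''uc : UniformContinuous f'') :
    TendstoUniformly
      (fun (n : ℕ) (y : ℝ) =>
        (n : ℝ) * a n * Real.exp (-(b n) * DE y) * (f (y + 1 / n) - f y)
          + (n : ℝ) * a n * Real.exp (b n * DE y) * (f (y - 1 / n) - f y))
      (fun y => -2 * ω * DE y * f' y + ω * h * f'' y) atTop := by
  have hωh : 0 < ω * h := mul_pos hω hh
  have hinv : Tendsto (fun n : ℕ => 1 / (n : ℝ)) atTop (𝓝 0) := tendsto_one_div_atTop_nhds_zero_nat
  have hb0 : Tendsto b atTop (𝓝 0) := by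
    have hlim := hnb.mul hinv
    rw [mul_zero] at hlim
    refine hlim.congr' ?_
    filter_upwards [eventually_gt_atTop 0] with n hn
    have : (n : ℝ) ≠ 0 := by positivity
    field_simp
  have hc : Tendsto (fun n : ℕ => a n / n) atTop (𝓝 (ω * h)) := by
    have hlim := hab.div hnb (by positivity)
    rw [div_div_eq_mul_div, div_one] at hlim
    refine hlim.congr fun n => ?_
    exact mul_div_mul_right _ _ (hb n).ne'
  rw [Metric.tendstoUniformly_iff]
  intro ε hε
  obtain ⟨δ, hδ, hmod⟩ := Metric.uniformContinuous_iff.mp hf''uc (ε / (12 * (ω * h)))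
    (by positivity)
  have hbound : Tendsto (fun n : ℕ =>
      2 * Mf * (a n * b n * b n * R ^ 2 + |a n * b n - ω| * R)
        + Mf * (a n / n * (b n * R) ^ 2 + |a n / n - ω * h|)
        + 6 * (a n / n) * (ε / (12 * (ω * h)))) atTop (𝓝 (ε / 2)) := by
    have hlim := ((((hab.mul hb0).mul_const (R ^ 2)).add
      ((hab.sub_const ω).abs.mul_const R)).const_mul (2 * Mf)).add
      (((hc.mul ((hb0.mul_const R).pow 2)).add (hc.sub_const (ω * h)).abs).const_mul Mf)
      |>.add ((hc.const_mul 6).mul_const (ε / (12 * (ω * h))))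
    convert hlim using 2
    simp
    field_simp
    norm_num
  have hbR : Tendsto (fun n => b n * R) atTop (𝓝 0) := by simpa using hb0.mul_const R
  filter_upwards [hbound.eventually_lt_const (half_lt_self hε), hbR.eventually_le_const one_pos,
    hinv.eventually_lt_const hδ, eventually_gt_atTop 0] with n hlt hle hnδ hn y
  have hN : (0 : ℝ) < n := Nat.cast_pos.mpr hn
  have hosc : ∀ t : ℝ, |t| = 1 / n → ∀ z, |z - y| ≤ |t| →
      |f'' z - f'' y| ≤ ε / (12 * (ω * h)) := fun t ht z hz =>
    (hmod (show dist z y < δ by rw [Real.dist_eq]; linarith)).le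
  have hp := abs_taylor_two_remainder_le hf1 hf2 (hosc (1 / n) (abs_of_pos (by positivity)))
  have hq := abs_taylor_two_remainder_le hf1 hf2
    (hosc (-(1 / n)) (by rw [abs_neg]; exact abs_of_pos (by positivity)))
  rw [neg_sq] at hq
  have hmain := abs_jump_generator_sub_le (ω := ω) (k := ω * h) hN (ha n) (hb n) (hDEb y) hle
    (hf'b y) (hf''b y) hp hq
  rw [dist_comm, Real.dist_eq]
  refine lt_of_le_of_lt (le_of_eq_of_le ?_ hmain) hlt
  congr 1
  ring_nf
end

section
/- (Convergence of the nonlinear generators H_n.) Let E satisfy the energy condition, fix ω > 0 and 0 < δ < 1, and set β_n := n^{−δ}, α_n := ω/β_n, m_n := n^{1−δ}. For f : ℝ × [0,T] → ℝ of class C² with compact support, define H_n f(x,t) := ω·n^{2δ}·[ e^{−n^{−δ}·∇E(x,t)}·( e^{n^{1−δ}·(f(x+1/n,t) − f(x,t))} − 1 ) + e^{n^{−δ}·∇E(x,t)}·( e^{n^{1−δ}·(f(x−1/n,t) − f(x,t))} − 1 ) ] + ∂_t f(x,t). Then sup_{(x,t) ∈ ℝ × [0,T]} | H_n f(x,t)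 − ( −2ω·∇E(x,t)·∇f(x,t) + ω·(∇f(x,t))² + ∂_t f(x,t) ) | → 0 as n → ∞, where ∇f := ∂_x f. -/
open Real Filter Topology Set

/-- First-order Taylor estimate for a function with Lipschitz derivative. -/
lemma abs_taylor_sub_le_of_lipschitzWith {g g' : ℝ → ℝ} {K : NNReal}
    (hg : ∀ y, HasDerivAt g (g' y) y) (hK : LipschitzWith K g') (x h : ℝ) :
    |g (x + h) - g x - h * g' x| ≤ K * h ^ 2 := by
  have hderiv : ∀ y ∈ uIcc x (x + h),
      HasDerivWithinAt (fun z => g z - z * g' x) (g' y - 1 * g' x) (uIcc x (x + h)) y :=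
    fun y _ => ((hg y).sub ((hasDerivAt_id y).mul_const (g' x))).hasDerivWithinAt
  have hbound : ∀ y ∈ uIcc x (x + h), ‖g' y - 1 * g' x‖ ≤ K * |h| := by
    intro y hy
    have hdist := hK.dist_le_mul y x
    have habs := abs_sub_left_of_mem_uIcc hy
    rw [Real.dist_eq, Real.dist_eq] at hdist
    rw [one_mul, Real.norm_eq_abs]
    refine hdist.trans (mul_le_mul_of_nonneg_left ?_ K.coe_nonneg)
    simpa using habs
  have hmean := (convex_uIcc x (x + h)).norm_image_sub_le_of_norm_hasDerivWithin_le
    hderiv hbound left_mem_uIcc right_mem_uIcc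
  simp only [Real.norm_eq_abs, add_sub_cancel_left] at hmean
  calc |g (x + h) - g x - h * g' x|
      = |g (x + h) - (x + h) * g' x - (g x - x * g' x)| := by ring_nf
    _ ≤ K * |h| * |h| := hmean
    _ = K * h ^ 2 := by rw [mul_assoc, abs_mul_abs_self, sq]

/-- The horizontal derivative of a compactly supported `C²` function of two variables is bounded
and uniformly Lipschitz in the horizontal variable. -/
lemma exists_bound_and_lipschitzWith_of_contDiff_two {f fx : ℝ → ℝ → ℝ}
    (hf : ContDiff ℝ 2 fun p : ℝ × ℝ => f p.1 p.2)
    (hfsupp : HasCompactSupport fun p : ℝ × ℝ => f p.1 p.2)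
    (hfx : ∀ y t, HasDerivAt (fun z => f z t) (fx y t) y) :
    ∃ (M : ℝ) (K : NNReal), (∀ y t, |fx y t| ≤ M) ∧ ∀ t, LipschitzWith K fun y => fx y t := by
  set G : ℝ × ℝ → ℝ := fun p => fderiv ℝ (fun p : ℝ × ℝ => f p.1 p.2) p (1, 0)
  have hGfx : ∀ y t, G (y, t) = fx y t := by
    intro y t
    have hF := (hf.differentiable (by norm_num) (y, t)).hasFDerivAt
    have hline : HasDerivAt (fun z : ℝ => (z, t)) ((1 : ℝ), (0 : ℝ)) y :=
      (hasDerivAt_id y).prodMk (hasDerivAt_const y t)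
    have hcomp := hF.comp_hasDerivAt y hline
    exact hcomp.unique (hfx y t)
  have hGdiff : ContDiff ℝ 1 G := by
    have := hf.fderiv_right (m := 1) (by norm_num)
    exact this.clm_apply contDiff_const
  have hGsupp : HasCompactSupport G := hfsupp.fderiv_apply (𝕜 := ℝ) (1, 0)
  obtain ⟨M, hM⟩ := hGsupp.exists_bound_of_continuous hGdiff.continuous
  obtain ⟨K, hK⟩ := hGdiff.lipschitzWith_of_hasCompactSupport hGsupp (by norm_num)
  refine ⟨M, K, fun y t => ?_, fun t => LipschitzWith.of_dist_le_mul fun y z => ?_⟩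
  · simpa [hGfx] using hM (y, t)
  · have := hK.dist_le_mul (y, t) (z, t)
    simpa [hGfx, Prod.dist_eq] using this

/-- Second-order Taylor estimate for the exponential. -/
lemma abs_exp_sub_quadratic_le {y a : ℝ} (hy : |y| ≤ a) (ha : a ≤ 1) :
    |exp y - 1 - y - y ^ 2 / 2| ≤ a ^ 3 := by
  have hexp := Real.exp_bound (hy.trans ha) (n := 3) (by norm_num)
  norm_num [Finset.sum_range_succ, Nat.factorial] at hexp
  have hpow : |y| ^ 3 ≤ a ^ 3 := pow_le_pow_left₀ (abs_nonneg y) hy 3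
  have hnonneg : 0 ≤ |y| ^ 3 := by positivity
  rw [show exp y - 1 - y - y ^ 2 / 2 = exp y - (1 + y + y ^ 2 / 2) by ring]
  linarith

lemma abs_exp_add_sub_exp_le {w s c : ℝ} (hw : |w| ≤ 1) (hs : |s| ≤ c) (hc : c ≤ 1) :
    |exp (w + s) - exp w| ≤ 6 * c := by
  have hexp : exp w ≤ 3 :=
    (exp_le_exp.mpr ((le_abs_self w).trans hw)).trans (exp_one_lt_d9.le.trans (by norm_num))
  have hs' := Real.abs_exp_sub_one_le (hs.trans hc)
  rw [exp_add, ← mul_sub_one, abs_mul, abs_of_pos (exp_pos w)]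
  calc exp w * |exp s - 1| ≤ 3 * (2 * |s|) := by gcongr
    _ ≤ 6 * c := by linarith

/-- The pointwise expansion of a pair of exponentially tilted symmetric jumps. -/
lemma abs_tilted_jumps_sub_le {b D p s s' R M c : ℝ} (hb : 0 < b) (hD : |D| ≤ R) (hp : |p| ≤ M)
    (hs : |s| ≤ c) (hs' : |s'| ≤ c) (hc : c ≤ 1) (hRM : b * (R + M) ≤ 1) :
    |exp (-b * D) * (exp (b * p + s) - 1) + exp (b * D) * (exp (-(b * p) + s') - 1)
        - b ^ 2 * (-2 * D * p + p ^ 2)| ≤ 12 * c + 4 * (b * (R + M)) ^ 3 := by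
  have hM : 0 ≤ M := (abs_nonneg p).trans hp
  have hu : |-(b * D)| ≤ b * (R + M) := by
    rw [abs_neg, abs_mul, abs_of_pos hb]
    gcongr
    linarith
  have hw : |b * p - b * D| ≤ b * (R + M) := by
    rw [← mul_sub, abs_mul, abs_of_pos hb]
    gcongr
    linarith [abs_sub p D]
  have hu' : |b * D| ≤ b * (R + M) := by simpa using hu
  have hw' : |-(b * p - b * D)| ≤ b * (R + M) := by rwa [abs_neg]
  have e₁ := abs_le.mp (abs_exp_sub_quadratic_le hu hRM)
  have e₂ := abs_le.mp (abs_exp_sub_quadratic_le hu' hRM)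
  have e₃ := abs_le.mp (abs_exp_sub_quadratic_le hw hRM)
  have e₄ := abs_le.mp (abs_exp_sub_quadratic_le hw' hRM)
  have e₅ := abs_le.mp (abs_exp_add_sub_exp_le (hw.trans hRM) hs hc)
  have e₆ := abs_le.mp (abs_exp_add_sub_exp_le (hw'.trans hRM) hs' hc)
  rw [mul_sub_one, mul_sub_one, ← exp_add, ← exp_add,
    show -b * D + (b * p + s) = b * p - b * D + s by ring,
    show b * D + (-(b * p) + s') = -(b * p - b * D) + s' by ring, neg_mul]
  rw [abs_le]
  constructor <;> nlinarith

/-- convergence of the nonlinear generators `H_n`: with `β_n = n^{−δ}`,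
`α_n = ω/β_n`, `m_n = n^{1−δ}`, `0 < δ < 1`, and `f : ℝ × [0,T] → ℝ` of class `C²` with
compact support (with `∇f = ∂_x f = fx` and `∂_t f = ft`), the nonlinear generators
`H_n f(x,t) = ω n^{2δ} [e^{−n^{−δ}∇E}(e^{n^{1−δ}(f(x+1/n,t)−f(x,t))} − 1)
  + e^{n^{−δ}∇E}(e^{n^{1−δ}(f(x−1/n,t)−f(x,t))} − 1)] + ∂_t f(x,t)`
converge uniformly on `ℝ × [0,T]` to
`H f(x,t) = −2ω ∇E ∇f + ω (∇f)² + ∂_t f`. -/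
theorem nonlinear_generator_convergence
    (T : ℝ) (hT : 0 < T)
    -- the energy `E` with spatial derivative `∇E = DE`, satisfying condition (2.8)
    (E DE : ℝ → ℝ → ℝ) (R L : ℝ)
    (hEcont : Continuous fun p : ℝ × ℝ => E p.1 p.2)
    (hDEcont : Continuous fun p : ℝ × ℝ => DE p.1 p.2)
    (hDE : ∀ y t, HasDerivAt (fun z => E z t) (DE y t) y)
    (hEnonneg : ∀ y t, 0 ≤ E y t)
    (hDEbound : ∀ y t, |DE y t| ≤ R)
    (hDELip : ∀ y s t, |DE y t - DE y s| ≤ L * |t - s|)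
    (ω δ : ℝ) (hω : 0 < ω) (hδ0 : 0 < δ) (hδ1 : δ < 1)
    -- the test function `f`, of class `C²` with compact support
    (f fx ft : ℝ → ℝ → ℝ)
    (hf : ContDiff ℝ 2 fun p : ℝ × ℝ => f p.1 p.2)
    (hfsupp : HasCompactSupport fun p : ℝ × ℝ => f p.1 p.2)
    (hfx : ∀ y t, HasDerivAt (fun z => f z t) (fx y t) y)
    (hft : ∀ y t, HasDerivAt (fun τ => f y τ) (ft y t) t) :
    TendstoUniformlyOn
      (fun (n : ℕ) (p : ℝ × ℝ) =>
        ω * (n : ℝ) ^ (2 * δ) *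
            (Real.exp (-((n : ℝ) ^ (-δ)) * DE p.1 p.2) *
                (Real.exp ((n : ℝ) ^ (1 - δ) * (f (p.1 + 1 / n) p.2 - f p.1 p.2)) - 1)
              + Real.exp ((n : ℝ) ^ (-δ) * DE p.1 p.2) *
                (Real.exp ((n : ℝ) ^ (1 - δ) * (f (p.1 - 1 / n) p.2 - f p.1 p.2)) - 1))
          + ft p.1 p.2)
      (fun p => -2 * ω * DE p.1 p.2 * fx p.1 p.2 + ω * fx p.1 p.2 ^ 2 + ft p.1 p.2)
      atTop (Set.univ ×ˢ Set.Icc 0 T) := by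
  obtain ⟨M, K, hM, hK⟩ := exists_bound_and_lipschitzWith_of_contDiff_two hf hfsupp hfx
  have hb_lim : Tendsto (fun n : ℕ => (n : ℝ) ^ (-δ)) atTop (𝓝 0) :=
    (tendsto_rpow_neg_atTop hδ0).comp tendsto_natCast_atTop_atTop
  have hq_lim : Tendsto (fun n : ℕ => (n : ℝ) ^ (-(1 - δ))) atTop (𝓝 0) :=
    (tendsto_rpow_neg_atTop (sub_pos.mpr hδ1)).comp tendsto_natCast_atTop_atTop
  have hRM_lim : Tendsto (fun n : ℕ => (n : ℝ) ^ (-δ) * (R + M)) atTop (𝓝 0) := by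
    simpa using hb_lim.mul_const (R + M)
  have hc_lim : Tendsto (fun n : ℕ => K * (((n : ℝ) ^ (-δ)) ^ 2 * (n : ℝ) ^ (-(1 - δ))))
      atTop (𝓝 0) := by
    simpa using ((hb_lim.pow 2).mul hq_lim).const_mul (K : ℝ)
  have herr_lim : Tendsto (fun n : ℕ => ω * (12 * (K * (n : ℝ) ^ (-(1 - δ)))
      + 4 * ((n : ℝ) ^ (-δ) * (R + M) ^ 3))) atTop (𝓝 0) := by
    simpa using (((hq_lim.const_mul (K : ℝ)).const_mul 12).add
      ((hb_lim.mul_const ((R + M) ^ 3)).const_mul 4)).const_mul ω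
  rw [Metric.tendstoUniformlyOn_iff]
  intro ε hε
  filter_upwards [eventually_gt_atTop 0, hRM_lim.eventually_le_const one_pos,
    hc_lim.eventually_le_const one_pos, herr_lim.eventually_lt_const hε]
    with n hn hRM hc herr p _
  obtain ⟨x, t⟩ := p
  have hn' : (0 : ℝ) < n := Nat.cast_pos.mpr hn
  have hb : 0 < (n : ℝ) ^ (-δ) := rpow_pos_of_pos hn' _
  have hm : (n : ℝ) ^ (1 - δ) = (n : ℝ) ^ (-δ) * n := by
    rw [sub_eq_neg_add, rpow_add_one hn'.ne']
  have hsq : (n : ℝ) ^ (2 * δ) = (((n : ℝ) ^ (-δ)) ^ 2)⁻¹ := by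
    rw [← rpow_natCast, ← rpow_mul hn'.le, ← rpow_neg hn'.le]
    congr 1
    push_cast
    ring
  have hq : (n : ℝ) ^ (-(1 - δ)) = ((n : ℝ) ^ (-δ) * n)⁻¹ := by
    rw [rpow_neg hn'.le, hm]
  rw [hq] at hc herr
  rw [Real.dist_eq, abs_sub_comm]
  simp only [hm, hsq]
  generalize (n : ℝ) ^ (-δ) = b at *
  have hremainder : ∀ h : ℝ, h ^ 2 = (1 / (n : ℝ)) ^ 2 →
      |b * n * (f (x + h) t - f x t - h * fx x t)| ≤ K * (b ^ 2 * (b * n)⁻¹) := by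
    intro h hh
    have htaylor := abs_taylor_sub_le_of_lipschitzWith (fun y => hfx y t) (hK t) x h
    rw [abs_mul, abs_of_pos (mul_pos hb hn')]
    calc b * n * |f (x + h) t - f x t - h * fx x t| ≤ b * n * (K * (1 / (n : ℝ)) ^ 2) := by
          rw [← hh]
          gcongr
      _ = K * (b ^ 2 * (b * n)⁻¹) := by
          field_simp
  have hjump := abs_tilted_jumps_sub_le hb (hDEbound x t) (hM x t)
    (hremainder (1 / n) rfl) (hremainder (-(1 / n)) (neg_sq _)) hc hRM
  have hright : b * fx x t + b * n * (f (x + 1 / n) t - f x t - 1 / n * fx x t)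
      = b * n * (f (x + 1 / n) t - f x t) := by
    field_simp
    ring
  have hleft : -(b * fx x t) + b * n * (f (x + -(1 / n)) t - f x t - -(1 / n) * fx x t)
      = b * n * (f (x - 1 / n) t - f x t) := by
    rw [← sub_eq_add_neg]
    field_simp
    ring
  rw [hright, hleft] at hjump
  refine lt_of_le_of_lt ?_ herr
  set S := exp (-b * DE x t) * (exp (b * n * (f (x + 1 / n) t - f x t)) - 1)
    + exp (b * DE x t) * (exp (b * n * (f (x - 1 / n) t - f x t)) - 1)
  have hfactor : ω * (b ^ 2)⁻¹ * S + ft x t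
        - (-2 * ω * DE x t * fx x t + ω * fx x t ^ 2 + ft x t)
      = ω * (b ^ 2)⁻¹ * (S - b ^ 2 * (-2 * DE x t * fx x t + fx x t ^ 2)) := by
    field_simp
    ring
  rw [hfactor, abs_mul, abs_of_pos (by positivity)]
  calc ω * (b ^ 2)⁻¹ * |S - b ^ 2 * (-2 * DE x t * fx x t + fx x t ^ 2)|
      ≤ ω * (b ^ 2)⁻¹ * (12 * (K * (b ^ 2 * (b * n)⁻¹)) + 4 * (b * (R + M)) ^ 3) := by gcongr
    _ = ω * (12 * (K * (b * n)⁻¹) + 4 * (b * (R + M) ^ 3)) := by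
      field_simp
end

section
/- (Resolvent solvability.) Let ω, h > 0 and let E : ℝ → ℝ be C¹ with ∇E := E′ bounded and uniformly continuous. Then there exists λ₀ > 0 such that for every λ ≥ λ₀ and every continuous compactly supported g : ℝ → ℝ there exists f : ℝ → ℝ of class C², bounded with bounded f′ and bounded, uniformly continuous f″, with f(x) → 0 as |x| → ∞, satisfying −ω·h·f″(x) + 2ω·∇E(x)·f′(x) + λ·f(x) = g(x) for all x ∈ ℝ. -/
open Real Filter Topology Set
open MeasureTheory ZeroAtInfty

/-- The causal exponential average `x ↦ ∫₀^∞ e^{-μt} u(x - t) dt`, which inverts `d/dx + μ`. -/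
noncomputable def expAverage (μ : ℝ) (u : ℝ → ℝ) (x : ℝ) : ℝ :=
  ∫ t in Ioi (0 : ℝ), exp (-μ * t) * u (x - t)

lemma integrableOn_expAverage_kernel {μ : ℝ} (hμ : 0 < μ) {u : ℝ → ℝ} (hu : Continuous u)
    {C : ℝ} (hC : ∀ y, |u y| ≤ C) (x : ℝ) :
    IntegrableOn (fun t => exp (-μ * t) * u (x - t)) (Ioi 0) := by
  refine Integrable.mul_bdd (c := C) (exp_neg_integrableOn_Ioi 0 hμ) ?_ ?_
  · exact (hu.comp (by fun_prop)).aestronglyMeasurable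
  · exact .of_forall fun t => hC _

lemma integral_exp_neg_mul_Ioi_zero {μ : ℝ} (hμ : 0 < μ) :
    ∫ t in Ioi (0 : ℝ), exp (-μ * t) = μ⁻¹ := by
  rw [integral_exp_mul_Ioi (by linarith) 0]
  simp [neg_div]

lemma abs_expAverage_le {μ : ℝ} (hμ : 0 < μ) {u : ℝ → ℝ} {C : ℝ} (hC : ∀ y, |u y| ≤ C) (x : ℝ) :
    |expAverage μ u x| ≤ C / μ := by
  have := norm_integral_le_of_norm_le (μ := volume.restrict (Ioi (0 : ℝ)))
    (f := fun t => exp (-μ * t) * u (x - t)) ((exp_neg_integrableOn_Ioi 0 hμ).mul_const C)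
    (.of_forall fun t => by
      rw [norm_mul, norm_of_nonneg (exp_pos _).le]
      exact mul_le_mul_of_nonneg_left (hC _) (exp_pos _).le)
  rw [integral_mul_const, integral_exp_neg_mul_Ioi_zero hμ] at this
  rw [div_eq_inv_mul]
  exact this

lemma expAverage_sub {μ : ℝ} (hμ : 0 < μ) {u v : ℝ → ℝ} (hu : Continuous u) (hv : Continuous v)
    {C D : ℝ} (hC : ∀ y, |u y| ≤ C) (hD : ∀ y, |v y| ≤ D) (x : ℝ) :
    expAverage μ (u - v) x = expAverage μ u x - expAverage μ v x := by
  unfold expAverage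
  rw [← integral_sub (integrableOn_expAverage_kernel hμ hu hC x)
    (integrableOn_expAverage_kernel hμ hv hD x)]
  simp [mul_sub]

lemma tendsto_expAverage_cocompact {μ : ℝ} (hμ : 0 < μ) {u : ℝ → ℝ} (hu : Continuous u)
    {C : ℝ} (hC : ∀ y, |u y| ≤ C) (hu0 : Tendsto u (cocompact ℝ) (𝓝 0)) :
    Tendsto (expAverage μ u) (cocompact ℝ) (𝓝 0) := by
  have : (cocompact ℝ).IsCountablyGenerated := by
    rw [cocompact_eq_atBot_atTop]; infer_instance
  have key := tendsto_integral_filter_of_dominated_convergence (l := cocompact ℝ)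
    (μ := volume.restrict (Ioi (0 : ℝ))) (F := fun x t => exp (-μ * t) * u (x - t))
    (f := fun _ => 0) (fun t => exp (-μ * t) * C)
    (.of_forall fun x => (integrableOn_expAverage_kernel hμ hu hC x).aestronglyMeasurable)
    (.of_forall fun x => .of_forall fun t => by
      rw [norm_mul, norm_of_nonneg (exp_pos _).le]
      exact mul_le_mul_of_nonneg_left (hC _) (exp_pos _).le)
    ((exp_neg_integrableOn_Ioi 0 hμ).mul_const C)
    (.of_forall fun t => by
      have hshift : Tendsto (fun x : ℝ => x - t) (cocompact ℝ) (cocompact ℝ) :=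
        (Homeomorph.subRight t).isClosedEmbedding.tendsto_cocompact
      simpa using (hu0.comp hshift).const_mul (exp (-μ * t)))
  rwa [integral_zero] at key

lemma expAverage_eq_exp_mul_integral_Iic (μ : ℝ) (u : ℝ → ℝ) (x : ℝ) :
    expAverage μ u x = exp (-μ * x) * ∫ y in Iic x, exp (μ * y) * u y := by
  have h1 : expAverage μ u x = ∫ t, (Iio x).indicator (fun y => exp (-μ * (x - y)) * u y) t := by
    rw [expAverage, ← integral_indicator measurableSet_Ioi,
      ← integral_sub_left_eq_self _ volume x]
    congr 1 with t
    simp [indicator, sub_pos]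
  rw [h1, integral_indicator measurableSet_Iio, ← integral_Iic_eq_integral_Iio,
    ← integral_const_mul]
  congr 1 with y
  rw [← mul_assoc, ← exp_add]
  ring_nf

lemma hasDerivAt_expAverage {μ : ℝ} (hμ : 0 < μ) {u : ℝ → ℝ} (hu : Continuous u)
    {C : ℝ} (hC : ∀ y, |u y| ≤ C) (x : ℝ) :
    HasDerivAt (expAverage μ u) (u x - μ * expAverage μ u x) x := by
  set F : ℝ → ℝ := fun y => exp (μ * y) * u y with hF
  have hFc : Continuous F := by fun_prop
  have hint : ∀ a, IntegrableOn F (Iic a) := fun a => by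
    refine Integrable.mul_bdd (c := C) (integrableOn_exp_mul_Iic hμ a) ?_ ?_
    · exact hu.aestronglyMeasurable
    · exact .of_forall fun t => hC _
  have hK : ∀ z, ∫ y in Iic z, F y = (∫ y in Iic 0, F y) + ∫ y in (0 : ℝ)..z, F y := fun z => by
    rw [← intervalIntegral.integral_Iic_sub_Iic (hint 0) (hint z)]; ring
  have hKd : HasDerivAt (fun z => ∫ y in Iic z, F y) (F x) x := by
    rw [funext hK]
    exact (intervalIntegral.integral_hasDerivAt_right (hFc.intervalIntegrable _ _)
      (hFc.stronglyMeasurableAtFilter _ _) hFc.continuousAt).const_add _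
  have hexp : HasDerivAt (fun z => exp (-μ * z)) (exp (-μ * x) * (-μ)) x := by
    simpa using ((hasDerivAt_id x).const_mul (-μ)).exp
  have hd := hexp.mul hKd
  have hfun : expAverage μ u = (fun z => exp (-μ * z)) * fun z => ∫ y in Iic z, F y := by
    ext z; exact expAverage_eq_exp_mul_integral_Iic μ u z
  have hone : exp (-μ * x) * exp (μ * x) = 1 := by rw [← exp_add]; simp
  rw [← hfun] at hd
  refine hd.congr_deriv ?_
  rw [expAverage_eq_exp_mul_integral_Iic, hF]
  linear_combination u x * hone

/-- The anticausal exponential average `x ↦ ∫₀^∞ e^{-μt} u(x + t) dt`, which inverts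
`-d/dx + μ`. -/
noncomputable def expAverageRight (μ : ℝ) (u : ℝ → ℝ) (x : ℝ) : ℝ :=
  expAverage μ (fun y => u (-y)) (-x)

lemma hasDerivAt_expAverageRight {μ : ℝ} (hμ : 0 < μ) {u : ℝ → ℝ} (hu : Continuous u)
    {C : ℝ} (hC : ∀ y, |u y| ≤ C) (x : ℝ) :
    HasDerivAt (expAverageRight μ u) (μ * expAverageRight μ u x - u x) x := by
  have hd := (hasDerivAt_expAverage hμ (hu.comp continuous_neg) (fun y => hC (-y)) (-x)).scomp x
    (hasDerivAt_neg x)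
  refine hd.congr_deriv ?_
  simp [expAverageRight, Function.comp_def]

lemma tendsto_expAverageRight_cocompact {μ : ℝ} (hμ : 0 < μ) {u : ℝ → ℝ} (hu : Continuous u)
    {C : ℝ} (hC : ∀ y, |u y| ≤ C) (hu0 : Tendsto u (cocompact ℝ) (𝓝 0)) :
    Tendsto (expAverageRight μ u) (cocompact ℝ) (𝓝 0) := by
  have hneg : Tendsto (fun x : ℝ => -x) (cocompact ℝ) (cocompact ℝ) :=
    (Homeomorph.neg ℝ).isClosedEmbedding.tendsto_cocompact
  exact (tendsto_expAverage_cocompact hμ (hu.comp continuous_neg) (fun y => hC (-y))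
    (hu0.comp hneg)).comp hneg

lemma ZeroAtInftyContinuousMap.abs_apply_le_norm (u : C₀(ℝ, ℝ)) (y : ℝ) : |u y| ≤ ‖u‖ :=
  u.toBCF.norm_coe_le_norm y

/-- The fixed-point form of the perturbed resolvent equation: for a bounded continuous
coefficient `b` that is small relative to `μ`, the density `u` solves
`u = g - b (R u - L u)` with `L`, `R` the two exponential averages. -/
lemma exists_zeroAtInfty_eq_sub_mul_expAverage {μ B : ℝ} (hμ : 0 < μ) {b : ℝ → ℝ}
    (hb : Continuous b) (hbB : ∀ y, |b y| ≤ B) (hBμ : 4 * B ≤ μ) (g : C₀(ℝ, ℝ)) :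
    ∃ u : C₀(ℝ, ℝ), ∀ x, u x = g x - b x * (expAverageRight μ u x - expAverage μ u x) := by
  have hB : 0 ≤ B := (abs_nonneg _).trans (hbB 0)
  have hex : ∀ u : C₀(ℝ, ℝ), ∃ v : C₀(ℝ, ℝ), ∀ x,
      v x = g x - b x * (expAverageRight μ u x - expAverage μ u x) := fun u => by
    have hu := u.abs_apply_le_norm
    have hL : Continuous (expAverage μ u) := continuous_iff_continuousAt.2 fun x =>
      (hasDerivAt_expAverage hμ (map_continuous u) hu x).continuousAt
    have hR : Continuous (expAverageRight μ u) := continuous_iff_continuousAt.2 fun x =>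
      (hasDerivAt_expAverageRight hμ (map_continuous u) hu x).continuousAt
    have hlim : Tendsto (fun x => b x * (expAverageRight μ u x - expAverage μ u x))
        (cocompact ℝ) (𝓝 0) := by
      refine isBoundedUnder_le_mul_tendsto_zero
        (isBoundedUnder_of ⟨B, hbB⟩) ?_
      simpa using (tendsto_expAverageRight_cocompact hμ (map_continuous u) hu u.zero_at_infty').sub
        (tendsto_expAverage_cocompact hμ (map_continuous u) hu u.zero_at_infty')
    exact ⟨⟨⟨fun x => g x - b x * (expAverageRight μ u x - expAverage μ u x), by fun_prop⟩,
      by simpa using g.zero_at_infty'.sub hlim⟩, fun x => rfl⟩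
  choose T hT using hex
  have hcontr : ContractingWith (1 / 2) T := by
    refine ⟨by rw [← NNReal.coe_lt_coe]; norm_num, LipschitzWith.of_dist_le_mul fun u v => ?_⟩
    rw [← ZeroAtInftyContinuousMap.dist_toBCF_eq_dist]
    refine (BoundedContinuousFunction.dist_le (by positivity)).2 fun x => ?_
    have huv : ∀ y, |(⇑u - ⇑v) y| ≤ dist u v := fun y => by
      rw [dist_eq_norm]; exact (u - v).abs_apply_le_norm y
    have hL := abs_expAverage_le hμ huv x
    have hR := abs_expAverage_le hμ (u := fun y => (⇑u - ⇑v) (-y)) (fun y => huv (-y)) (-x)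
    rw [expAverage_sub hμ (map_continuous u) (map_continuous v)
      u.abs_apply_le_norm v.abs_apply_le_norm] at hL
    have hsub := expAverage_sub hμ ((map_continuous u).comp continuous_neg)
      ((map_continuous v).comp continuous_neg) (fun y => u.abs_apply_le_norm (-y))
      (fun y => v.abs_apply_le_norm (-y)) (-x)
    have hR' : |expAverageRight μ u x - expAverageRight μ v x| ≤ dist u v / μ := by
      rw [expAverageRight, expAverageRight]
      exact hsub ▸ hR
    have hdiff : T u x - T v x = -(b x * ((expAverageRight μ u x - expAverageRight μ v x)
        - (expAverage μ u x - expAverage μ v x))) := by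
      rw [hT, hT]; ring
    change dist (T u x) (T v x) ≤ _
    rw [Real.dist_eq, hdiff, abs_neg, abs_mul]
    calc _ ≤ B * (dist u v / μ + dist u v / μ) :=
          mul_le_mul (hbB x) ((abs_sub _ _).trans (add_le_add hR' hL)) (abs_nonneg _) hB
      _ = 2 * B / μ * dist u v := by ring
      _ ≤ _ := by
          refine mul_le_mul_of_nonneg_right ?_ dist_nonneg
          rw [div_le_iff₀ hμ]
          push_cast
          linarith
  refine ⟨hcontr.fixedPoint T, fun x => ?_⟩
  conv_lhs => rw [← hcontr.fixedPoint_isFixedPt]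
  exact hT _ x

/-- resolvent solvability: let `ω, h > 0` and `E : ℝ → ℝ` be `C¹` with
`∇E = E′` bounded and uniformly continuous.  Then there is `λ₀ > 0` such that for every
`λ ≥ λ₀` and every continuous compactly supported `g` there is a `C²` function `f`,
bounded with bounded `f′` and bounded uniformly continuous `f″`, vanishing at infinity,
such that `−ωh f″ + 2ω ∇E f′ + λ f = g` on `ℝ`. -/
theorem resolvent_solvability
    (ω h : ℝ) (hω : 0 < ω) (hh : 0 < h)
    (E DE : ℝ → ℝ) (hE : ∀ y, HasDerivAt E (DE y) y)
    (R : ℝ) (hDEb : ∀ y, |DE y| ≤ R) (hDEuc : UniformContinuous DE) :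
    ∃ lam0 : ℝ, 0 < lam0 ∧ ∀ lam : ℝ, lam0 ≤ lam →
      ∀ g : ℝ → ℝ, Continuous g → HasCompactSupport g →
        ∃ f f' f'' : ℝ → ℝ,
          (∀ y, HasDerivAt f (f' y) y) ∧
          (∀ y, HasDerivAt f' (f'' y) y) ∧
          (∃ M : ℝ, ∀ y, |f y| ≤ M ∧ |f' y| ≤ M ∧ |f'' y| ≤ M) ∧
          UniformContinuous f'' ∧
          Tendsto f (Filter.cocompact ℝ) (𝓝 0) ∧
          ∀ y, -(ω * h) * f'' y + 2 * ω * DE y * f' y + lam * f y = g y := by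
  have hR : 0 ≤ R := (abs_nonneg _).trans (hDEb 0)
  refine ⟨ω * h * (4 * (R / h) + 1) ^ 2, by positivity, fun lam hlam g hg hgs => ?_⟩
  have hωh : 0 < ω * h := by positivity
  set μ : ℝ := √(lam / (ω * h)) with hμdef
  have hμge : 4 * (R / h) + 1 ≤ μ := by
    refine le_sqrt_of_sq_le ?_
    rw [le_div_iff₀ hωh]
    linarith
  have hμ : 0 < μ := lt_of_lt_of_le (by positivity) hμge
  have hlam0 : 0 ≤ lam := le_trans (by positivity) hlam
  have hμsq : ω * h * μ ^ 2 = lam := by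
    rw [hμdef, sq_sqrt (by positivity)]
    field_simp
  have hgsupp : HasCompactSupport fun x => g x / (ω * h) :=
    hgs.comp_left (g := fun z => z / (ω * h)) (by simp)
  obtain ⟨u, hu⟩ := exists_zeroAtInfty_eq_sub_mul_expAverage (μ := μ) (B := R / h) hμ
    (b := fun x => DE x / h) (hDEuc.continuous.div_const h)
    (fun y => by
      rw [abs_div, abs_of_pos hh]
      exact div_le_div_of_nonneg_right (hDEb y) hh.le)
    (by linarith)
    ⟨⟨fun x => g x / (ω * h), by fun_prop⟩, hgsupp.is_zero_at_infty⟩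
  have hub := u.abs_apply_le_norm
  set L := expAverage μ u with hLdef
  set P := expAverageRight μ u with hPdef
  have hL := hasDerivAt_expAverage hμ (map_continuous u) hub
  have hP := hasDerivAt_expAverageRight hμ (map_continuous u) hub
  have hL0 := tendsto_expAverage_cocompact hμ (map_continuous u) hub u.zero_at_infty'
  have hP0 := tendsto_expAverageRight_cocompact hμ (map_continuous u) hub u.zero_at_infty'
  rw [← hLdef] at hL hL0
  rw [← hPdef] at hP hP0
  have hLc : Continuous L := continuous_iff_continuousAt.2 fun x => (hL x).continuousAt
  have hPc : Continuous P := continuous_iff_continuousAt.2 fun x => (hP x).continuousAt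
  let Lz : C₀(ℝ, ℝ) := ⟨⟨L, hLc⟩, hL0⟩
  let Pz : C₀(ℝ, ℝ) := ⟨⟨P, hPc⟩, hP0⟩
  let f : C₀(ℝ, ℝ) := (2 * μ)⁻¹ • (Lz + Pz)
  let f' : C₀(ℝ, ℝ) := (2 : ℝ)⁻¹ • (Pz - Lz)
  let f'' : C₀(ℝ, ℝ) := (μ / 2) • (Lz + Pz) - u
  have hf : ∀ y, f y = (2 * μ)⁻¹ * (L y + P y) := fun y => rfl
  have hf' : ∀ y, f' y = 2⁻¹ * (P y - L y) := fun y => rfl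
  have hf'' : ∀ y, f'' y = μ / 2 * (L y + P y) - u y := fun y => rfl
  refine ⟨f, f', f'', fun y => ?_, fun y => ?_,
    ⟨max ‖f‖ (max ‖f'‖ ‖f''‖), fun y => ⟨(f.abs_apply_le_norm y).trans (by simp),
      (f'.abs_apply_le_norm y).trans (by simp), (f''.abs_apply_le_norm y).trans (by simp)⟩⟩,
    ZeroAtInftyContinuousMap.uniformContinuous f'', f.zero_at_infty', fun y => ?_⟩
  · refine (((hL y).add (hP y)).const_mul (2 * μ)⁻¹).congr_deriv ?_
    rw [hf']
    field_simp
    ring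
  · refine (((hP y).sub (hL y)).const_mul (2 : ℝ)⁻¹).congr_deriv ?_
    rw [hf'']
    ring
  · have huy : u y = g y / (ω * h) - DE y / h * (P y - L y) := hu y
    rw [hf, hf', hf'', huy, ← hμsq]
    field_simp
    ring
end

section
/- (Rate-independent pointwise limits.) Let A > 0 and for β > 0 set α_β := e^{−βA}. Then, as β → ∞: (i) ψ*_{α_β,β}(w) → 0 for every w with |w| ≤ A, and ψ*_{α_β,β}(w) → +∞ for every w with |w| > A; (ii) ψ_{α_β,β}(v) → A·|v| for every v ∈ ℝ. -/
open Real Filter Topology Set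

/-- The dissipation potential is even in the rate `v`. -/
lemma psi_abs {a : ℝ} (ha : 0 < a) (b v : ℝ) : psi a b |v| = psi a b v := by
  rcases abs_choice v with h | h
  · rw [h]
  · rw [h]
    have hs : Real.sqrt (v ^ 2 + 4 * a ^ 2) ^ 2 = v ^ 2 + 4 * a ^ 2 :=
      Real.sq_sqrt (by positivity)
    have hlt : |v| < Real.sqrt (v ^ 2 + 4 * a ^ 2) := by
      apply Real.lt_sqrt_of_sq_lt
      rw [sq_abs]
      have := pow_pos ha 2
      linarith
    have hv := abs_lt.1 hlt
    unfold psi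
    rw [neg_sq]
    set s := Real.sqrt (v ^ 2 + 4 * a ^ 2)
    have hinv : (-v + s) / (2 * a) = ((v + s) / (2 * a))⁻¹ := by
      have : v + s ≠ 0 := by linarith
      field_simp
      linarith
    rw [hinv, Real.log_inv]
    ring

lemma psiStar_abs (a b w : ℝ) : psiStar a b |w| = psiStar a b w := by
  rcases abs_choice w with h | h <;> simp [psiStar, h]

lemma tendsto_exp_neg_mul_atTop {A : ℝ} (hA : 0 < A) :
    Tendsto (fun β : ℝ => Real.exp (-β * A)) atTop (𝓝 0) :=
  Real.tendsto_exp_atBot.comp (tendsto_neg_atTop_atBot.atBot_mul_const hA)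

lemma tendsto_psiStar_zero {A w : ℝ} (hw : |w| ≤ A) :
    Tendsto (fun β : ℝ => psiStar (Real.exp (-β * A)) β w) atTop (𝓝 0) := by
  have hlim : Tendsto (fun β : ℝ => 2 / β) atTop (𝓝 0) := tendsto_const_nhds.div_atTop tendsto_id
  refine squeeze_zero' ?_ ?_ hlim
  · filter_upwards [eventually_gt_atTop 0] with β hβ
    have := Real.one_le_cosh (β * w)
    exact mul_nonneg (by positivity) (by linarith)
  · filter_upwards [eventually_gt_atTop 0] with β hβ
    rw [← psiStar_abs, psiStar]
    have hcosh : Real.cosh (β * |w|) - 1 ≤ Real.exp (β * A) := by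
      have h₁ : Real.exp (β * |w|) ≤ Real.exp (β * A) := by gcongr
      have h₂ : Real.exp (-(β * |w|)) ≤ 1 := Real.exp_le_one_iff.2 (by
        have := mul_nonneg hβ.le (abs_nonneg w)
        linarith)
      have h₃ := Real.exp_pos (β * A)
      rw [Real.cosh_eq]
      linarith
    calc 2 * Real.exp (-β * A) / β * (Real.cosh (β * |w|) - 1)
        ≤ 2 * Real.exp (-β * A) / β * Real.exp (β * A) := by gcongr
      _ = 2 / β * (Real.exp (-β * A) * Real.exp (β * A)) := by ring
      _ = 2 / β := by rw [← Real.exp_add]; simp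

lemma tendsto_psiStar_atTop {A w : ℝ} (hA : 0 < A) (hw : A < |w|) :
    Tendsto (fun β : ℝ => psiStar (Real.exp (-β * A)) β w) atTop atTop := by
  have hc : 0 < |w| - A := sub_pos.2 hw
  have hlim : Tendsto (fun β : ℝ => (|w| - A) ^ 2 / 2 * β - 2) atTop atTop :=
    tendsto_atTop_add_const_right _ _ (tendsto_id.const_mul_atTop (by positivity))
  refine tendsto_atTop_mono' _ ?_ hlim
  filter_upwards [eventually_ge_atTop 1] with β hβ
  have hβ₀ : 0 < β := by linarith
  have hquad : (β * (|w| - A)) ^ 2 / 2 ≤ Real.exp (β * (|w| - A)) := by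
    have := Real.quadratic_le_exp_of_nonneg (mul_pos hβ₀ hc).le
    have := mul_pos hβ₀ hc
    linarith
  have hsmall : Real.exp (-β * A) ≤ 1 := Real.exp_le_one_iff.2 (by nlinarith)
  have hcosh : Real.exp (-β * A) * Real.exp (β * |w|) ≤
      2 * Real.exp (-β * A) * Real.cosh (β * |w|) := by
    have := mul_pos (Real.exp_pos (-β * A)) (Real.exp_pos (-(β * |w|)))
    rw [Real.cosh_eq]
    linarith
  have hexp : Real.exp (β * (|w| - A)) = Real.exp (-β * A) * Real.exp (β * |w|) := by
    rw [← Real.exp_add]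
    ring_nf
  rw [← psiStar_abs, psiStar, div_mul_eq_mul_div (2 * Real.exp (-β * A)), le_div_iff₀ hβ₀]
  linarith

lemma tendsto_psi_of_pos {A v : ℝ} (hA : 0 < A) (hv : 0 < v) :
    Tendsto (fun β : ℝ => psi (Real.exp (-β * A)) β v) atTop (𝓝 (A * v)) := by
  have ha := tendsto_exp_neg_mul_atTop hA
  have hs : Tendsto (fun β : ℝ => Real.sqrt (v ^ 2 + 4 * Real.exp (-β * A) ^ 2)) atTop (𝓝 v) := by
    have := (((ha.pow 2).const_mul 4).const_add (v ^ 2)).sqrt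
    simpa [Real.sqrt_sq hv.le] using this
  have hlog := ((hs.const_add v).log (by positivity)).sub_const (Real.log 2)
  have hlim := ((((hlog.div_atTop tendsto_id).add_const A).const_mul v).sub
    (hs.div_atTop tendsto_id)).add ((ha.const_mul 2).div_atTop tendsto_id)
  have hval : v * (0 + A) - 0 + 0 = A * v := by ring
  rw [hval] at hlim
  refine hlim.congr' ?_
  filter_upwards [eventually_gt_atTop 0] with β hβ
  have hne : v + Real.sqrt (v ^ 2 + 4 * Real.exp (-β * A) ^ 2) ≠ 0 := by positivity
  rw [psi, Real.log_div hne (by positivity), Real.log_mul two_ne_zero (Real.exp_ne_zero _),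
    Real.log_exp, id]
  field_simp
  ring

lemma tendsto_psi {A : ℝ} (hA : 0 < A) (v : ℝ) :
    Tendsto (fun β : ℝ => psi (Real.exp (-β * A)) β v) atTop (𝓝 (A * |v|)) := by
  rcases eq_or_ne v 0 with rfl | hv
  · have hzero (β : ℝ) : psi (Real.exp (-β * A)) β 0 = 0 := by
      have hsq : (0 : ℝ) ^ 2 + 4 * Real.exp (-β * A) ^ 2 = (2 * Real.exp (-β * A)) ^ 2 := by ring
      rw [psi, hsq, Real.sqrt_sq (by positivity)]
      ring
    simp only [hzero, abs_zero, mul_zero, tendsto_const_nhds]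
  · simpa only [psi_abs (Real.exp_pos _)] using tendsto_psi_of_pos hA (abs_pos.2 hv)

/-- rate-independent pointwise limits: let `A > 0` and `α_β = e^{−βA}`.
As `β → ∞`: (i) `ψ*_{α_β,β}(w) → 0` if `|w| ≤ A` and `ψ*_{α_β,β}(w) → +∞` if `|w| > A`;
(ii) `ψ_{α_β,β}(v) → A|v|` for every `v`. -/
theorem rate_independent_pointwise_limits (A : ℝ) (hA : 0 < A) :
    (∀ w : ℝ, |w| ≤ A →
      Tendsto (fun β : ℝ => psiStar (Real.exp (-β * A)) β w) atTop (𝓝 0)) ∧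
    (∀ w : ℝ, A < |w| →
      Tendsto (fun β : ℝ => psiStar (Real.exp (-β * A)) β w) atTop atTop) ∧
    (∀ v : ℝ,
      Tendsto (fun β : ℝ => psi (Real.exp (-β * A)) β v) atTop (𝓝 (A * |v|))) := by
  exact ⟨fun _ hw => tendsto_psiStar_zero hw, fun _ hw => tendsto_psiStar_atTop hA hw,
    tendsto_psi hA⟩
end

section
/- (Convexity lemma for conjugate pairs.) Let ψ : ℝ → ℝ be convex and continuous and let ψ*(w) := sup_{v ∈ ℝ}(v·w − ψ(v)) be its Legendre conjugate. Suppose ψ* is finite and differentiable at points z and z + η with η ≥ 0, and suppose (ψ*)′(z + η) = a·(ψ*)′(z) for some a ≥ 1. Then ψ( a·(ψ*)′(z) ) ≤ ψ( (ψ*)′(z) ) + (z + η)·(a − 1)·(ψ*)′(z). -/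
open Real Filter Topology Set

/-- If `ψs` is the Legendre conjugate of a continuous `ψ` near `y`, the supremum defining
`ψs y` is attained. -/
theorem exists_conjugate_eq {ψ ψs : ℝ → ℝ} (hψ : Continuous ψ) {y : ℝ}
    (hy : ∀ᶠ w in 𝓝 y, IsLUB (Set.range fun v : ℝ => v * w - ψ v) (ψs w)) :
    ∃ v, ψs y = v * y - ψ v := by
  obtain ⟨ε, hε, hball⟩ := Metric.eventually_nhds_iff.1 hy
  have bound : ∀ w, |w - y| < ε → ∀ v, v * w - ψ v ≤ ψs w := fun w hw v =>
    (hball (by rwa [Real.dist_eq])).1 (Set.mem_range_self v)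
  have habs : |ε / 2| < ε := by rw [abs_of_pos (half_pos hε)]; exact half_lt_self hε
  have htop : Tendsto (fun v => v * y - ψ v) atTop atBot := by
    refine tendsto_atBot_mono (f := fun v => ψs (y + ε / 2) + -(v * (ε / 2))) (fun v => ?_) ?_
    · have := bound (y + ε / 2) (by simpa using habs) v
      linarith
    · exact tendsto_atBot_add_const_left _ _
        (tendsto_neg_atTop_atBot.comp (tendsto_id.atTop_mul_const (half_pos hε)))
  have hbot : Tendsto (fun v => v * y - ψ v) atBot atBot := by
    refine tendsto_atBot_mono (f := fun v => ψs (y - ε / 2) + v * (ε / 2)) (fun v => ?_) ?_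
    · have := bound (y - ε / 2) (by simpa using habs) v
      linarith
    · exact tendsto_atBot_add_const_left _ _ (tendsto_id.atBot_mul_const (half_pos hε))
  have hcont : Continuous fun v => v * y - ψ v := by fun_prop
  obtain ⟨v, hv⟩ := hcont.exists_forall_ge
    (by rw [cocompact_eq_atBot_atTop]; exact hbot.sup htop)
  refine ⟨v, hy.self_of_nhds.unique (IsGreatest.isLUB ⟨Set.mem_range_self v, ?_⟩)⟩
  rintro _ ⟨u, rfl⟩
  exact hv u

/-- Fenchel equality at the derivative of the Legendre conjugate. -/
theorem conjugate_eq_of_hasDerivAt {ψ ψs : ℝ → ℝ} (hψ : Continuous ψ) {y p : ℝ}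
    (hy : ∀ᶠ w in 𝓝 y, IsLUB (Set.range fun v : ℝ => v * w - ψ v) (ψs w))
    (hp : HasDerivAt ψs p y) : ψs y = p * y - ψ p := by
  obtain ⟨v, hv⟩ := exists_conjugate_eq hψ hy
  have hmin : IsLocalMin (fun w => ψs w - v * w) y := by
    filter_upwards [hy] with w hw
    have := hw.1 (Set.mem_range_self v)
    linarith
  have hzero := hmin.hasDerivAt_eq_zero (hp.sub ((hasDerivAt_id y).const_mul v))
  obtain rfl : p = v := by linarith
  exact hv

/-- convexity lemma for conjugate pairs: let `ψ : ℝ → ℝ` be convex and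
continuous, and let `ψs` be its Legendre conjugate near `z` and near `z + η`, i.e.
`ψs w` is the least upper bound of `{ v·w − ψ(v) : v ∈ ℝ }` for `w` in a neighbourhood
of `z` and of `z + η` (in particular `ψ*` is finite there).  Assume `η ≥ 0`, `a ≥ 1`,
that `ψs` is differentiable at `z` with derivative `dz` and at `z + η` with derivative
`a·dz`.  Then `ψ(a·(ψ*)′(z)) ≤ ψ((ψ*)′(z)) + (z + η)(a − 1)(ψ*)′(z)`. -/
theorem convexity_lemma_conjugate_pair
    (ψ ψs : ℝ → ℝ) (hψconv : ConvexOn ℝ Set.univ ψ) (hψcont : Continuous ψ)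
    (z η a dz : ℝ) (hη : 0 ≤ η) (ha : 1 ≤ a)
    (hz : ∀ᶠ w in 𝓝 z, IsLUB (Set.range fun v : ℝ => v * w - ψ v) (ψs w))
    (hzη : ∀ᶠ w in 𝓝 (z + η), IsLUB (Set.range fun v : ℝ => v * w - ψ v) (ψs w))
    (hd1 : HasDerivAt ψs dz z)
    (hd2 : HasDerivAt ψs (a * dz) (z + η)) :
    ψ (a * dz) ≤ ψ dz + (z + η) * (a - 1) * dz := by
  have heq := conjugate_eq_of_hasDerivAt hψcont hzη hd2
  have hle := hzη.self_of_nhds.1 (Set.mem_range_self dz)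
  linarith
end

section
/- (Compactness in the rate-independent limit.) Let A > 0, let β_n → ∞ and α_n := e^{−β_n A}. Let x_n ∈ W^{1,1}(0,T) satisfy J_{α_n,β_n}(x_n) ≤ C, |x_n(0)| ≤ C, and ∫₀ᵗ ∂_t E(x_n(s),s) ds ≤ C for all n and all t ∈ [0,T], for some constant C. Then sup_n ( ∫₀ᵀ |ẋ_n(t)| dt + sup_{t ∈ [0,T]} |x_n(t)| ) < ∞, and there exist a subsequence (n_k) and a function x : [0,T] → ℝ of bounded pointwise variation such that x_{n_k}(t) → x(t) for every t ∈ [0,T]. -/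
open MeasureTheory Real Filter Topology Set

/-- A uniformly bounded sequence of real functions has a subsequence which converges at every point
of a given countable set. -/
lemma exists_subseq_tendsto_of_countable {ι : Type*} {S : Set ι} (hS : S.Countable)
    {f : ℕ → ι → ℝ} {B : ℝ} (hB : ∀ n x, |f n x| ≤ B) :
    ∃ φ : ℕ → ℕ, StrictMono φ ∧
      ∀ x ∈ S, ∃ l, Tendsto (fun k => f (φ k) x) atTop (𝓝 l) := by
  have : Countable S := hS.to_subtype
  have hK : IsCompact (Set.univ.pi fun _ : S => Set.Icc (-B) B) :=
    isCompact_univ_pi fun _ => isCompact_Icc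
  obtain ⟨g, -, φ, hφ, hg⟩ := hK.tendsto_subseq (x := fun n (x : S) => f n x)
    fun n x _ => abs_le.mp (hB n x)
  exact ⟨φ, hφ, fun x hx => ⟨g ⟨x, hx⟩, (tendsto_pi_nhds.mp hg) ⟨x, hx⟩⟩⟩

/-- **Helly's selection theorem** for uniformly bounded monotone functions on the line. -/
lemma exists_subseq_tendsto_of_monotone {f : ℕ → ℝ → ℝ} {B : ℝ}
    (hf : ∀ n, Monotone (f n)) (hB : ∀ n x, |f n x| ≤ B) :
    ∃ φ : ℕ → ℕ, StrictMono φ ∧ ∃ g : ℝ → ℝ, Monotone g ∧ (∀ x, |g x| ≤ B) ∧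
      ∀ x, Tendsto (fun k => f (φ k) x) atTop (𝓝 (g x)) := by
  obtain ⟨φ, hφ, hlim⟩ := exists_subseq_tendsto_of_countable
    (Set.countable_range ((↑) : ℚ → ℝ)) hB
  set u : ℝ → ℝ := fun x => limsup (fun k => f (φ k) x) atTop
  have hle : ∀ x, IsBoundedUnder (· ≤ ·) atTop fun k => f (φ k) x := fun x =>
    isBoundedUnder_of ⟨B, fun k => (abs_le.mp (hB _ _)).2⟩
  have hge : ∀ x, IsBoundedUnder (· ≥ ·) atTop fun k => f (φ k) x := fun x =>
    isBoundedUnder_of ⟨-B, fun k => (abs_le.mp (hB _ _)).1⟩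
  have humono : Monotone u := fun x y hxy =>
    limsup_le_limsup (Eventually.of_forall fun k => hf _ hxy) (hge x).isCoboundedUnder_le (hle y)
  have hrat : ∀ q : ℚ, Tendsto (fun k => f (φ k) q) atTop (𝓝 (u q)) := by
    intro q
    obtain ⟨l, hl⟩ := hlim q ⟨q, rfl⟩
    rwa [show u q = l from hl.limsup_eq]
  have hcont : ∀ x, ContinuousAt u x → Tendsto (fun k => f (φ k) x) atTop (𝓝 (u x)) := by
    intro x hx
    refine tendsto_order.mpr ⟨fun a ha => ?_, fun a ha => ?_⟩
    · obtain ⟨y, hyx, hy⟩ := exists_Ioc_subset_of_mem_nhds (hx.eventually_const_lt ha)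
        ⟨x - 1, by simp⟩
      obtain ⟨q, hyq, hqx⟩ := exists_rat_btwn hyx
      filter_upwards [(hrat q).eventually_const_lt (hy ⟨hyq, hqx.le⟩)] with k hk
      exact hk.trans_le (hf _ hqx.le)
    · obtain ⟨y, hyx, hy⟩ := exists_Ico_subset_of_mem_nhds (hx.eventually_lt_const ha)
        ⟨x + 1, by simp⟩
      obtain ⟨q, hxq, hqy⟩ := exists_rat_btwn hyx
      filter_upwards [(hrat q).eventually_lt_const (hy ⟨hxq.le, hqy⟩)] with k hk
      exact (hf _ hxq.le).trans_lt hk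
  obtain ⟨χ, hχ, hlim'⟩ := exists_subseq_tendsto_of_countable humono.countable_not_continuousAt
    (f := fun k => f (φ k)) fun n x => hB _ x
  have hall : ∀ x, ∃ l, Tendsto (fun k => f (φ (χ k)) x) atTop (𝓝 l) := by
    intro x
    by_cases hx : ContinuousAt u x
    · exact ⟨u x, (hcont x hx).comp hχ.tendsto_atTop⟩
    · exact hlim' x hx
  choose g hg using hall
  refine ⟨φ ∘ χ, hφ.comp hχ, g, fun x y hxy => ?_, fun x => ?_, hg⟩
  · exact le_of_tendsto_of_tendsto' (hg x) (hg y) fun k => hf _ hxy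
  · exact le_of_tendsto' (hg x).abs fun k => hB _ x

lemma BoundedVariationOn.sub_of_real {f g : ℝ → ℝ} {s : Set ℝ} (hf : BoundedVariationOn f s)
    (hg : BoundedVariationOn g s) : BoundedVariationOn (fun x => f x - g x) s := by
  refine ne_top_of_le_ne_top (ENNReal.add_ne_top.mpr ⟨hf, hg⟩) (iSup_le fun p => ?_)
  calc
    _ ≤ ∑ i ∈ Finset.range p.1, (edist (f (p.2.1 (i + 1))) (f (p.2.1 i))
          + edist (g (p.2.1 (i + 1))) (g (p.2.1 i))) := by
      refine Finset.sum_le_sum fun i _ => ?_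
      simp only [edist_dist]
      rw [← ENNReal.ofReal_add dist_nonneg dist_nonneg]
      exact ENNReal.ofReal_le_ofReal (dist_sub_sub_le _ _ _ _)
    _ ≤ _ := by
      rw [Finset.sum_add_distrib]
      exact add_le_add (eVariationOn.sum_le p.2.2.1 p.2.2.2) (eVariationOn.sum_le p.2.2.1 p.2.2.2)

/-- Differences of uniformly bounded monotone functions admit a pointwise convergent subsequence
whose limit has bounded variation. -/
lemma exists_subseq_tendsto_sub_of_monotone {f g : ℕ → ℝ → ℝ} {B : ℝ}
    (hf : ∀ n, Monotone (f n)) (hfB : ∀ n x, |f n x| ≤ B)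
    (hg : ∀ n, Monotone (g n)) (hgB : ∀ n x, |g n x| ≤ B) (s : Set ℝ) :
    ∃ φ : ℕ → ℕ, StrictMono φ ∧ ∃ y : ℝ → ℝ, BoundedVariationOn y s ∧
      ∀ x, Tendsto (fun k => f (φ k) x - g (φ k) x) atTop (𝓝 (y x)) := by
  obtain ⟨φ, hφ, F, hF, hFB, hFlim⟩ := exists_subseq_tendsto_of_monotone hf hfB
  obtain ⟨χ, hχ, G, hG, hGB, hGlim⟩ := exists_subseq_tendsto_of_monotone
    (f := fun k => g (φ k)) (fun n => hg _) (fun n => hgB _)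
  refine ⟨φ ∘ χ, hφ.comp hχ, fun x => F x - G x, ?_, fun x => ?_⟩
  · exact ((hF.monotoneOn s).boundedVariationOn fun x _ => hFB x).sub_of_real
      ((hG.monotoneOn s).boundedVariationOn fun x _ => hGB x)
  · exact ((hFlim x).comp hχ.tendsto_atTop).sub (hGlim x)

lemma psiStar_nonneg {a b : ℝ} (ha : 0 < a) (hb : 0 < b) (w : ℝ) : 0 ≤ psiStar a b w :=
  mul_nonneg (by positivity) (sub_nonneg.mpr (Real.one_le_cosh _))

lemma psiStar_exp_le {A b : ℝ} (hA : 0 < A) (hb : 0 < b) :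
    psiStar (Real.exp (-b * A)) b A ≤ 1 / b := by
  have hprod : Real.exp (-b * A) * Real.exp (b * A) = 1 := by
    rw [← Real.exp_add]
    simp
  have hle : Real.exp (-b * A) ≤ 1 := Real.exp_le_one_iff.mpr (by nlinarith)
  have hpos := Real.exp_pos (-b * A)
  have h : psiStar (Real.exp (-b * A)) b A
      = (1 - (2 - Real.exp (-b * A)) * Real.exp (-b * A)) / b := by
    rw [psiStar, Real.cosh_eq, ← neg_mul]
    generalize Real.exp (-b * A) = e at hprod ⊢
    field_simp
    linear_combination hprod
  rw [h]
  gcongr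
  nlinarith

/-- Linear growth of `psi` in the scaling `α = exp (-β A)`. -/
lemma mul_abs_le_psi_exp {A b : ℝ} (hA : 0 < A) (hb : 0 < b) (v : ℝ) :
    A * |v| - 1 / b ≤ psi (Real.exp (-b * A)) b v := by
  have h := psiStar_exp_le hA hb
  have h₁ := mul_le_psi_add_psiStar (Real.exp_pos (-b * A)) hb v A
  have h₂ := mul_le_psi_add_psiStar (Real.exp_pos (-b * A)) hb v (-A)
  rw [psiStar_neg] at h₂
  rcases abs_cases v with ⟨hv, -⟩ | ⟨hv, -⟩ <;> rw [hv] <;> linarith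

lemma AbsolutelyContinuousOnInterval.of_dist_le {f g : ℝ → ℝ} {a b : ℝ}
    (hg : AbsolutelyContinuousOnInterval g a b)
    (hfg : ∀ s ∈ Set.uIcc a b, ∀ t ∈ Set.uIcc a b, dist (f s) (f t) ≤ dist (g s) (g t)) :
    AbsolutelyContinuousOnInterval f a b := by
  rw [absolutelyContinuousOnInterval_iff] at hg ⊢
  intro ε hε
  obtain ⟨δ, hδ, h⟩ := hg ε hε
  refine ⟨δ, hδ, fun I hI hlen => (Finset.sum_le_sum fun i hi => ?_).trans_lt (h I hI hlen)⟩
  exact hfg _ (hI.1 i hi).1 _ (hI.1 i hi).2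

/-- The chain rule for a `C¹` energy along an absolutely continuous curve, in integrated form. -/
lemma integral_energy_along_curve {T : ℝ} (hT : 0 < T) {E DE Et : ℝ → ℝ → ℝ} {R : ℝ}
    (hDEcont : Continuous fun p : ℝ × ℝ => DE p.1 p.2)
    (hEtcont : Continuous fun p : ℝ × ℝ => Et p.1 p.2)
    (hDE : ∀ y t, HasDerivAt (fun z => E z t) (DE y t) y)
    (hEt : ∀ y t, HasDerivAt (fun τ => E y τ) (Et y t) t)
    (hDEbound : ∀ y t, |DE y t| ≤ R)
    {x v : ℝ → ℝ} (hv : IntervalIntegrable v volume 0 T)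
    (hx : ∀ t ∈ Set.Icc 0 T, x t = x 0 + ∫ s in (0:ℝ)..t, v s) :
    ∫ t in (0:ℝ)..T, (v t * DE (x t) t + Et (x t) t) = E (x T) T - E (x 0) 0 := by
  have hI : Set.uIcc 0 T = Set.Icc 0 T := Set.uIcc_of_le hT.le
  have hR : 0 ≤ R := (abs_nonneg _).trans (hDEbound 0 0)
  have hsub : ∀ s ∈ Set.Icc 0 T, ∀ t ∈ Set.Icc 0 T, IntervalIntegrable v volume s t := by
    intro s hs t ht
    exact hv.mono_set (by rw [hI]; exact Set.uIcc_subset_Icc hs ht)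
  have hxcont : ContinuousOn x (Set.Icc 0 T) := by
    have h := hv.absolutelyContinuousOnInterval_intervalIntegral (c := 0) (by simp)
    have h' := h.continuousOn
    rw [hI] at h'
    exact (continuousOn_const.add h').congr hx
  obtain ⟨M, hM⟩ := ((isCompact_Icc.image_of_continuousOn hxcont).prod
    (isCompact_Icc (a := (0:ℝ)) (b := T))).exists_bound_of_continuousOn hEtcont.continuousOn
  have hM' : ∀ s ∈ Set.Icc 0 T, ∀ t ∈ Set.Icc 0 T, |Et (x s) t| ≤ M := fun s hs t ht =>
    hM (x s, t) ⟨⟨s, hs, rfl⟩, ht⟩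
  have hdom : IntervalIntegrable (fun s => R * |v s| + M) volume 0 T :=
    (hv.abs.const_mul R).add intervalIntegrable_const
  have hxdist : ∀ s ∈ Set.Icc 0 T, ∀ t ∈ Set.Icc 0 T, s ≤ t →
      |x t - x s| ≤ ∫ r in s..t, |v r| := by
    intro s hs t ht hst
    rw [hx t ht, hx s hs, add_sub_add_left_eq_sub,
      intervalIntegral.integral_interval_sub_left (hsub 0 (by simp [hT.le]) _ ht)
        (hsub 0 (by simp [hT.le]) _ hs)]
    exact intervalIntegral.abs_integral_le_integral_abs hst
  have hE : ∀ s ∈ Set.Icc 0 T, ∀ t ∈ Set.Icc 0 T, s ≤ t →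
      |E (x t) t - E (x s) s| ≤ ∫ r in s..t, (R * |v r| + M) := by
    intro s hs t ht hst
    have h₁ : |E (x t) t - E (x s) t| ≤ R * |x t - x s| :=
      convex_univ.norm_image_sub_le_of_norm_hasDerivWithin_le
        (fun y _ => (hDE y t).hasDerivWithinAt) (fun y _ => hDEbound y t)
        (Set.mem_univ _) (Set.mem_univ _)
    have h₂ : |E (x s) t - E (x s) s| ≤ M * |t - s| :=
      (convex_Icc 0 T).norm_image_sub_le_of_norm_hasDerivWithin_le
        (fun y _ => (hEt (x s) y).hasDerivWithinAt) (fun y hy => hM' s hs y hy) hs ht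
    rw [intervalIntegral.integral_add ((hsub s hs t ht).abs.const_mul R) intervalIntegrable_const,
      intervalIntegral.integral_const_mul, intervalIntegral.integral_const, smul_eq_mul]
    rw [abs_of_nonneg (sub_nonneg.mpr hst)] at h₂
    have h₃ := mul_le_mul_of_nonneg_left (hxdist s hs t ht hst) hR
    have h₄ := abs_sub_le (E (x t) t) (E (x s) t) (E (x s) s)
    linarith
  have hac : AbsolutelyContinuousOnInterval (fun t => E (x t) t) 0 T := by
    refine (hdom.absolutelyContinuousOnInterval_intervalIntegral (c := 0) (by simp)).of_dist_le ?_
    have key : ∀ s ∈ Set.Icc 0 T, ∀ t ∈ Set.Icc 0 T, s ≤ t →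
        dist (E (x s) s) (E (x t) t) ≤
          dist (∫ r in (0:ℝ)..s, (R * |v r| + M)) (∫ r in (0:ℝ)..t, (R * |v r| + M)) := by
      intro s hs t ht hst
      have hd : ∀ r ∈ Set.Icc 0 T, IntervalIntegrable (fun s => R * |v s| + M) volume 0 r :=
        fun r hr => ((hsub 0 (by simp [hT.le]) _ hr).abs.const_mul R).add intervalIntegrable_const
      rw [dist_comm, dist_comm (∫ r in (0:ℝ)..s, (R * |v r| + M)), Real.dist_eq, Real.dist_eq,
        intervalIntegral.integral_interval_sub_left (hd t ht) (hd s hs)]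
      exact (hE s hs t ht hst).trans (le_abs_self _)
    rw [hI]
    intro s hs t ht
    rcases le_total s t with h | h
    · exact key s hs t ht h
    · rw [dist_comm, dist_comm (∫ r in (0:ℝ)..s, (R * |v r| + M))]
      exact key t ht s hs h
  rw [← hac.integral_deriv_eq_sub]
  have hne : ∀ᵐ t : ℝ, t ≠ T := by simp [ae_iff]
  refine intervalIntegral.integral_congr_ae ?_
  filter_upwards [hv.ae_hasDerivAt_integral, hne] with t ht htT htI
  rw [Set.uIoc_of_le hT.le] at htI
  have hmem : t ∈ Set.Ioo 0 T := ⟨htI.1, lt_of_le_of_ne htI.2 htT⟩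
  have hxd : HasDerivAt x (v t) t := by
    refine ((ht (by rw [hI]; exact Set.Ioo_subset_Icc_self hmem) 0 (by simp)).const_add
      (x 0)).congr_of_eventuallyEq ?_
    filter_upwards [isOpen_Ioo.mem_nhds hmem] with r hr
    exact hx r (Set.Ioo_subset_Icc_self hr)
  have hstrict := hasStrictFDerivAt_uncurry_coprod (𝕜 := ℝ) (u := (x t, t)) (f := E)
    (f₁ := fun y τ => ContinuousLinearMap.toSpanSingleton ℝ (DE y τ))
    (f₂ := fun y τ => ContinuousLinearMap.toSpanSingleton ℝ (Et y τ))
    (Eventually.of_forall fun p => (hDE p.1 p.2).hasFDerivAt)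
    (Eventually.of_forall fun p => (hEt p.1 p.2).hasFDerivAt)
    ((ContinuousLinearMap.toSpanSingletonCLE (𝕜 := ℝ) (E := ℝ)).continuous.comp hDEcont).continuousAt
    ((ContinuousLinearMap.toSpanSingletonCLE (𝕜 := ℝ) (E := ℝ)).continuous.comp hEtcont).continuousAt
  have hd := hstrict.hasFDerivAt.comp_hasDerivAt (f := fun r => (x r, r)) t
    (hxd.prodMk (hasDerivAt_id t))
  have hd' : HasDerivAt (fun t => E (x t) t) (v t * DE (x t) t + Et (x t) t) t := by
    have hval : v t * DE (x t) t + Et (x t) t =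
        (ContinuousLinearMap.toSpanSingleton ℝ (DE (x t) t)).coprod
          (ContinuousLinearMap.toSpanSingleton ℝ (Et (x t) t)) (v t, 1) := by
      simp
    rw [hval]
    exact hd
  exact hd'.deriv.symm

lemma integral_le_of_lintegral_ofReal_le {X : Type*} [MeasurableSpace X] {μ : Measure X}
    {f : X → ℝ} {C : ℝ} (hf : Integrable f μ) (hC : 0 ≤ C)
    (h : ∫⁻ x, ENNReal.ofReal (f x) ∂μ ≤ ENNReal.ofReal C) : ∫ x, f x ∂μ ≤ C := by
  rw [integral_eq_lintegral_pos_part_sub_lintegral_neg_part hf]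
  have := ENNReal.toReal_le_of_le_ofReal hC h
  have h0 : 0 ≤ (∫⁻ x, ENNReal.ofReal (-f x) ∂μ).toReal := ENNReal.toReal_nonneg
  linarith

/-- Primitives of an `L¹`-bounded sequence with bounded initial values admit a pointwise convergent
subsequence whose limit has bounded variation. -/
lemma exists_subseq_tendsto_of_integral_abs_le {T : ℝ} {x v : ℕ → ℝ → ℝ} {B : ℝ}
    (hv : ∀ n, IntegrableOn (v n) (Set.Ioo 0 T))
    (hx : ∀ n, ∀ t ∈ Set.Icc 0 T, x n t = x n 0 + ∫ s in (0:ℝ)..t, v n s)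
    (hB : ∀ n, ∫ t in Set.Ioo 0 T, |v n t| ≤ B) (hx0 : ∀ n, |x n 0| ≤ B) :
    ∃ φ : ℕ → ℕ, StrictMono φ ∧ ∃ y : ℝ → ℝ, BoundedVariationOn y (Set.Icc 0 T) ∧
      ∀ t ∈ Set.Icc 0 T, Tendsto (fun k => x (φ k) t) atTop (𝓝 (y t)) := by
  set μ : Measure ℝ := volume.restrict (Set.Ioo 0 T) with hμ
  have hmono : ∀ w : ℝ → ℝ, Integrable w μ → (∀ t, 0 ≤ w t) →
      Monotone (fun t => ∫ s in Set.Iic t, w s ∂μ) := fun w hw h0 s t hst =>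
    setIntegral_mono_set hw.integrableOn (Eventually.of_forall h0)
      (Set.Iic_subset_Iic.mpr hst).eventuallyLE
  have hbd : ∀ w : ℝ → ℝ, Integrable w μ → (∀ t, 0 ≤ w t) → ∀ t,
      0 ≤ ∫ s in Set.Iic t, w s ∂μ ∧ ∫ s in Set.Iic t, w s ∂μ ≤ ∫ s, w s ∂μ := fun w hw h0 t =>
    ⟨integral_nonneg h0, setIntegral_le_integral hw (Eventually.of_forall h0)⟩
  have hi₁ : ∀ n, Integrable (fun t => |v n t|) μ := fun n => (hv n).abs
  have hi₂ : ∀ n, Integrable (fun t => |v n t| - v n t) μ := fun n => (hi₁ n).sub (hv n)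
  have h0₁ : ∀ n t, 0 ≤ |v n t| := fun n t => abs_nonneg _
  have h0₂ : ∀ n t, 0 ≤ |v n t| - v n t := fun n t => sub_nonneg.mpr (le_abs_self _)
  have htot : ∀ n, ∫ t, (|v n t| - v n t) ∂μ ≤ 2 * B := by
    intro n
    rw [integral_sub (hi₁ n) (hv n)]
    have h₁ : |∫ t, v n t ∂μ| ≤ ∫ t, |v n t| ∂μ := abs_integral_le_integral_abs
    have h₂ := (abs_le.mp h₁).1
    have h₃ := hB n
    linarith
  have hrepr : ∀ n, ∀ t ∈ Set.Icc 0 T, x n t =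
      (x n 0 + ∫ s in Set.Iic t, |v n s| ∂μ) - ∫ s in Set.Iic t, (|v n s| - v n s) ∂μ := by
    intro n t ht
    have hset : ∫ s in (0:ℝ)..t, v n s = ∫ s in Set.Iic t, v n s ∂μ := by
      rw [intervalIntegral.integral_of_le ht.1, hμ, Measure.restrict_restrict measurableSet_Iic]
      refine setIntegral_congr_set ?_
      have hne : ∀ᵐ s : ℝ, s ≠ T := by simp [ae_iff]
      filter_upwards [hne] with s hs
      refine propext ⟨fun h => ⟨h.2, h.1, lt_of_le_of_ne (h.2.trans ht.2) hs⟩,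
        fun h => ⟨h.2.1, h.1⟩⟩
    rw [integral_sub (hi₁ n).integrableOn (hv n).integrableOn, hx n t ht, hset]
    ring
  obtain ⟨φ, hφ, y, hy, hlim⟩ := exists_subseq_tendsto_sub_of_monotone (B := 2 * B)
    (f := fun n t => x n 0 + ∫ s in Set.Iic t, |v n s| ∂μ)
    (g := fun n t => ∫ s in Set.Iic t, (|v n s| - v n s) ∂μ)
    (fun n => (hmono _ (hi₁ n) (h0₁ n)).const_add _)
    (fun n t => by
      have h₁ := hbd _ (hi₁ n) (h0₁ n) t
      have h₂ := abs_le.mp (hx0 n)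
      have h₃ := hB n
      exact abs_le.mpr ⟨by linarith, by linarith⟩)
    (fun n => hmono _ (hi₂ n) (h0₂ n))
    (fun n t => by
      have h₁ := hbd _ (hi₂ n) (h0₂ n) t
      rw [abs_of_nonneg h₁.1]
      exact h₁.2.trans (htot n))
    (Set.Icc 0 T)
  exact ⟨φ, hφ, y, hy, fun t ht => (hlim t).congr fun k => (hrepr _ t ht).symm⟩

/-- compactness in the rate-independent limit: let `A > 0`, `β_n → ∞`,
`α_n = e^{−β_n A}`, and let `x_n ∈ W^{1,1}(0,T)` satisfy `J_{α_n,β_n}(x_n) ≤ C`,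
`|x_n(0)| ≤ C` and `∫₀ᵗ ∂_t E(x_n(s),s) ds ≤ C` for all `n` and `t ∈ [0,T]`.  Then the
total variations `∫₀ᵀ |ẋ_n|` and the sup norms of `x_n` are uniformly bounded, and some
subsequence of `x_n` converges pointwise on `[0,T]` to a function of bounded variation. -/
theorem rate_independent_compactness
    (T : ℝ) (hT : 0 < T)
    -- the energy `E`, spatial derivative `∇E = DE`, time derivative `∂_t E = Et`
    (E DE Et : ℝ → ℝ → ℝ) (R L : ℝ)
    (hEcont : Continuous fun p : ℝ × ℝ => E p.1 p.2)
    (hDEcont : Continuous fun p : ℝ × ℝ => DE p.1 p.2)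
    (hEtcont : Continuous fun p : ℝ × ℝ => Et p.1 p.2)
    (hDE : ∀ y t, HasDerivAt (fun z => E z t) (DE y t) y)
    (hEt : ∀ y t, HasDerivAt (fun τ => E y τ) (Et y t) t)
    (hEnonneg : ∀ y t, 0 ≤ E y t)
    (hDEbound : ∀ y t, |DE y t| ≤ R)
    (hDELip : ∀ y s t, |DE y t - DE y s| ≤ L * |t - s|)
    -- the scaling regime
    (A : ℝ) (hA : 0 < A)
    (β : ℕ → ℝ) (hβpos : ∀ n, 0 < β n) (hβ : Tendsto β atTop atTop)
    -- the curves `x_n` in `W^{1,1}(0,T)`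
    (xn xn' : ℕ → ℝ → ℝ)
    (hxn'int : ∀ n, IntegrableOn (xn' n) (Set.Ioo 0 T))
    (hxnac : ∀ n, ∀ t ∈ Set.Icc 0 T, xn n t = xn n 0 + ∫ s in (0:ℝ)..t, xn' n s)
    (hEtint : ∀ n, IntegrableOn (fun s => Et (xn n s) s) (Set.Ioo 0 T))
    -- the uniform bounds
    (C : ℝ)
    (hJ : ∀ n, (∫⁻ t in Set.Ioo 0 T, ENNReal.ofReal
        (psi (Real.exp (-β n * A)) (β n) (xn' n t)
          + psiStar (Real.exp (-β n * A)) (β n) (DE (xn n t) t)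
          + xn' n t * DE (xn n t) t)) ≤ ENNReal.ofReal C)
    (hx0 : ∀ n, |xn n 0| ≤ C)
    (hEtbound : ∀ n, ∀ t ∈ Set.Icc 0 T, (∫ s in Set.Ioo 0 t, Et (xn n s) s) ≤ C) :
    (∃ B : ℝ, ∀ n, (∫ t in Set.Ioo 0 T, |xn' n t|) ≤ B ∧
      ∀ t ∈ Set.Icc 0 T, |xn n t| ≤ B) ∧
    ∃ φ : ℕ → ℕ, StrictMono φ ∧ ∃ y : ℝ → ℝ,
      BoundedVariationOn y (Set.Icc 0 T) ∧
      ∀ t ∈ Set.Icc 0 T, Tendsto (fun k => xn (φ k) t) atTop (𝓝 (y t)) := by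
  have hC : 0 ≤ C := (abs_nonneg _).trans (hx0 0)
  obtain ⟨K, hK⟩ : ∃ K, ∀ n, 1 / β n ≤ K := by
    obtain ⟨K, hK⟩ := hβ.inv_tendsto_atTop.bddAbove_range
    exact ⟨K, fun n => by simpa using hK ⟨n, rfl⟩⟩
  obtain ⟨M, hM⟩ := (isCompact_Icc (a := -C) (b := C)).exists_bound_of_continuousOn
    (f := fun y => E y 0) (by fun_prop)
  have hM' : ∀ n, E (xn n 0) 0 ≤ M := fun n =>
    (le_abs_self _).trans (hM _ (abs_le.mp (hx0 n)))
  have hvi : ∀ n, IntervalIntegrable (xn' n) volume 0 T := fun n =>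
    (intervalIntegrable_iff_integrableOn_Ioo_of_le hT.le).mpr (hxn'int n)
  have hvar : ∀ n, ∫ t in Set.Ioo 0 T, |xn' n t| ≤ (C + C + M + T * K) / A := by
    intro n
    have hxcont : ContinuousOn (xn n) (Set.Icc 0 T) := by
      have h := ((hvi n).absolutelyContinuousOnInterval_intervalIntegral (c := 0)
        (by simp)).continuousOn
      rw [Set.uIcc_of_le hT.le] at h
      exact (continuousOn_const.add h).congr (hxnac n)
    have hDEint : IntegrableOn (fun t => xn' n t * DE (xn n t) t) (Set.Ioo 0 T) := by
      refine Integrable.mul_bdd (c := R) (hxn'int n) ?_ (Eventually.of_forall fun t => hDEbound _ _)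
      exact (hDEcont.comp_continuousOn ((hxcont.mono Set.Ioo_subset_Icc_self).prodMk
        continuousOn_id)).aestronglyMeasurable measurableSet_Ioo
    have habs : IntegrableOn (fun t => A * |xn' n t| - 1 / β n) (Set.Ioo 0 T) :=
      ((hxn'int n).abs.const_mul A).sub (integrable_const _)
    have hlow : ∫ t in Set.Ioo 0 T, (A * |xn' n t| - 1 / β n + xn' n t * DE (xn n t) t) ≤ C := by
      refine integral_le_of_lintegral_ofReal_le (habs.add hDEint) hC
        ((lintegral_mono fun t => ENNReal.ofReal_le_ofReal ?_).trans (hJ n))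
      have h₁ := mul_abs_le_psi_exp hA (hβpos n) (xn' n t)
      have h₂ := psiStar_nonneg (Real.exp_pos (-β n * A)) (hβpos n) (DE (xn n t) t)
      linarith
    have hchain := integral_energy_along_curve hT hDEcont hEtcont hDE hEt hDEbound (hvi n) (hxnac n)
    rw [intervalIntegral.integral_of_le hT.le, integral_Ioc_eq_integral_Ioo,
      integral_add hDEint (hEtint n)] at hchain
    rw [integral_add habs hDEint, integral_sub ((hxn'int n).abs.const_mul A) (integrable_const _),
      integral_const_mul] at hlow
    have hconst : ∫ _ in Set.Ioo 0 T, 1 / β n = T * (1 / β n) := by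
      simp [hT.le]
    have h₁ := hEtbound n T (Set.right_mem_Icc.mpr hT.le)
    have h₂ := hEnonneg (xn n T) T
    have h₃ := mul_le_mul_of_nonneg_left (hK n) hT.le
    have h₄ := hM' n
    rw [le_div_iff₀ hA]
    linarith
  set B := (C + C + M + T * K) / A
  have hB : 0 ≤ B := (integral_nonneg fun t => abs_nonneg (xn' 0 t)).trans (hvar 0)
  refine ⟨⟨C + B, fun n => ⟨(hvar n).trans (by linarith), fun t ht => ?_⟩⟩,
    exists_subseq_tendsto_of_integral_abs_le (B := C + B) hxn'int hxnac
      (fun n => (hvar n).trans (by linarith)) (fun n => (hx0 n).trans (by linarith))⟩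
  rw [hxnac n t ht]
  refine (abs_add_le _ _).trans (add_le_add (hx0 n) ?_)
  refine (intervalIntegral.abs_integral_le_integral_abs ht.1).trans (le_trans ?_ (hvar n))
  rw [← integral_Ioc_eq_integral_Ioo, intervalIntegral.integral_of_le ht.1]
  exact setIntegral_mono_set
    ((intervalIntegrable_iff_integrableOn_Ioc_of_le hT.le).mp (hvi n)).abs
    (Eventually.of_forall fun t => abs_nonneg _)
    (Set.Ioc_subset_Ioc_right ht.2).eventuallyLE
end
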